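/- If G is a minimal counterexample, then G contains no cycle of length 4. -/

import Mathlib

open SimpleGraph

/-- A `(1,2^k)`-packing edge-coloring encoded as a function assigning a color in
`Fin (k+1)` to each unordered pair. Color `0` is the 1-color (its class must be a
matching) and each color `i ≠ 0` is a 2-color (its class must be an induced matching). -/
def IsPackingEC {V : Type} (G : SimpleGraph V) (k : ℕ)
    (c : Sym2 V → Fin (k + 1)) : Prop :=
  (∀ a b x y : V, G.Adj a b → G.Adj x y → s(a, b) ≠ s(x, y) →
      c s(a, b) = 0 → c s(x, y) = 0 →
      a ≠ x ∧ a ≠ y ∧ b ≠ x ∧ b ≠ y) ∧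
  ∀ a b x y : V, G.Adj a b → G.Adj x y → s(a, b) ≠ s(x, y) →
      c s(a, b) = c s(x, y) → c s(a, b) ≠ 0 →
      (a ≠ x ∧ a ≠ y ∧ b ≠ x ∧ b ≠ y) ∧
      ¬G.Adj a x ∧ ¬G.Adj a y ∧ ¬G.Adj b x ∧ ¬G.Adj b y

/-- A good coloring: a `(1,2^7)`-packing edge-coloring in which every edge of the
1-color class (color `0`) has both endpoints of degree 3. -/
def GoodColoring {V : Type} (G : SimpleGraph V) (c : Sym2 V → Fin 8) : Prop :=
  IsPackingEC G 7 c ∧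
  ∀ a b : V, G.Adj a b → c s(a, b) = 0 →
    (G.neighborSet a).ncard = 3 ∧ (G.neighborSet b).ncard = 3

/-- A graph is subcubic if every vertex has degree at most 3. -/
def Subcubic {V : Type} (G : SimpleGraph V) : Prop :=
  ∀ v : V, (G.neighborSet v).ncard ≤ 3

/-- A minimal counterexample: a finite subcubic simple graph with no good coloring such
that every finite subcubic simple graph with smaller `|V| + |E|` has a good coloring. -/
def MinCounter (V : Type) [Finite V] (G : SimpleGraph V) : Prop :=
  Subcubic G ∧
  (¬∃ c : Sym2 V → Fin 8, GoodColoring G c) ∧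
  ∀ (W : Type) [Finite W] (H : SimpleGraph W), Subcubic H →
    Nat.card W + H.edgeSet.ncard < Nat.card V + G.edgeSet.ncard →
    ∃ c : Sym2 W → Fin 8, GoodColoring H c

/-- A system of distinct representatives exists as soon as every nonempty set of indices contains
an index, or one of the listed pairs of indices, whose lists cover enough elements. -/
theorem exists_sdr_of_pairs {α : Type*} [DecidableEq α] {n : ℕ} (l : Fin n → Finset α)
    (w : Fin n → ℕ) (P : List (Fin n × Fin n × ℕ)) (hw : ∀ i, w i ≤ (l i).card)
    (hP : ∀ p ∈ P, p.2.2 ≤ (l p.1 ∪ l p.2.1).card)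
    (h : ∀ s : Finset (Fin n), s.Nonempty →
      (∃ i ∈ s, s.card ≤ w i) ∨ ∃ p ∈ P, p.1 ∈ s ∧ p.2.1 ∈ s ∧ s.card ≤ p.2.2) :
    ∃ g : Fin n → α, Function.Injective g ∧ ∀ i, g i ∈ l i := by
  rw [← Finset.all_card_le_biUnion_card_iff_exists_injective]
  intro s
  rcases s.eq_empty_or_nonempty with rfl | hs
  · simp
  · rcases h s hs with ⟨i, hi, hc⟩ | ⟨p, hp, h1, h2, hc⟩
    · exact (hc.trans (hw i)).trans (Finset.card_le_card (Finset.subset_biUnion_of_mem l hi))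
    · exact (hc.trans (hP p hp)).trans (Finset.card_le_card (Finset.union_subset
        (Finset.subset_biUnion_of_mem l h1) (Finset.subset_biUnion_of_mem l h2)))

/-- Colors `e i` for the edges of a 4-cycle and `f i` for the edges leaving it, subject to the
palettes `A i` (colors seen by both cycle edges at vertex `i`) and `B i` (colors seen by the edge
leaving vertex `i`). The predicate `z` says which leaving edges get color `0`, and `D` which pairs
of leaving edges may share a nonzero color. -/
structure CycleColors (A B : Fin 4 → Finset (Fin 8)) (D : Fin 4 → Fin 4 → Prop)
    (z : Fin 4 → Prop) (e f : Fin 4 → Fin 8) : Prop where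
  e_zero : ∀ i, e i = 0 → ¬z i ∧ ¬z (i + 1)
  e_inj : ∀ i j, e i = e j → i = j ∨ e i = 0 ∧ j = i + 2
  e_ne_f : ∀ i j, e i = f j → e i = 0
  e_avoid : ∀ i, e i ∉ A i ∪ A (i + 1)
  f_zero : ∀ i, f i = 0 ↔ z i
  f_avoid : ∀ i, f i ∉ B i
  f_inj : ∀ i j, f i = f j → f i ≠ 0 → i = j ∨ D i j

theorem CycleColors.of_rotate {A B : Fin 4 → Finset (Fin 8)} {D : Fin 4 → Fin 4 → Prop}
    {z : Fin 4 → Prop} (k : Fin 4)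
    (h : ∃ e f, CycleColors (fun i => A (i + k)) (fun i => B (i + k))
      (fun i j => D (i + k) (j + k)) (fun i => z (i + k)) e f) :
    ∃ e f, CycleColors A B D z e f := by
  obtain ⟨e, f, h⟩ := h
  have h2 : ∀ i : Fin 4, i - k + k = i := fun i => sub_add_cancel i k
  have h3 : ∀ i : Fin 4, i - k + 1 + k = i + 1 := fun i => by rw [add_right_comm, h2]
  refine ⟨fun i => e (i - k), fun i => f (i - k), ?_, ?_, ?_, ?_, ?_, ?_, ?_⟩
  · intro i hi
    simpa [h2, h3] using h.e_zero (i - k) hi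
  · intro i j hij
    rcases h.e_inj _ _ hij with h' | ⟨h', h''⟩
    · exact Or.inl (sub_left_injective h')
    · refine Or.inr ⟨h', ?_⟩
      rw [← h2 j, h'', add_right_comm, h2]
  · intro i j hij
    exact h.e_ne_f _ _ hij
  · intro i
    simpa [h2, h3] using h.e_avoid (i - k)
  · intro i
    simpa [h2] using h.f_zero (i - k)
  · intro i
    simpa [h2] using h.f_avoid (i - k)
  · intro i j hij h0
    rcases h.f_inj _ _ hij h0 with h' | h'
    · exact Or.inl (sub_left_injective h')
    · right; simpa [h2] using h'

/-- The elements of `Fin 8` avoiding `0` and `X`. -/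
def free (X : Finset (Fin 8)) : Finset (Fin 8) := (insert 0 X)ᶜ

theorem mem_free {X : Finset (Fin 8)} {k : Fin 8} : k ∈ free X ↔ k ≠ 0 ∧ k ∉ X := by
  simp [free]

theorem le_card_free {X : Finset (Fin 8)} {n m : ℕ} (h : X.card ≤ n) (hm : m + n ≤ 7) :
    m ≤ (free X).card := by
  have h1 := Finset.card_insert_le 0 X
  have h2 := Finset.card_compl (insert 0 X)
  rw [Fintype.card_fin] at h2
  rw [free, h2]
  omega

theorem free_union_free (X Y : Finset (Fin 8)) : free X ∪ free Y = free (X ∩ Y) := by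
  ext k; simp only [Finset.mem_union, mem_free, Finset.mem_inter]; tauto

theorem card_union_le_of {X Y : Finset (Fin 8)} {n m : ℕ} (hX : X.card ≤ n) (hY : Y.card ≤ m) :
    (X ∪ Y).card ≤ n + m :=
  (Finset.card_union_le X Y).trans (add_le_add hX hY)

theorem le_card_free_union {X Y Z : Finset (Fin 8)} {n m : ℕ} (h : X ∩ Y ⊆ Z) (hZ : Z.card ≤ n)
    (hm : m + n ≤ 7) : m ≤ (free X ∪ free Y).card := by
  rw [free_union_free]
  exact le_card_free ((Finset.card_le_card h).trans hZ) hm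

theorem card_insert_le_of {a : Fin 8} {X : Finset (Fin 8)} {n : ℕ} (hX : X.card ≤ n) :
    (insert a X).card ≤ n + 1 :=
  (Finset.card_insert_le a X).trans (Nat.succ_le_succ hX)

section
variable {A B : Fin 4 → Finset (Fin 8)} {D : Fin 4 → Fin 4 → Prop} {z : Fin 4 → Prop}

theorem exists_cycleColors_zzzz (hB0 : ∀ i, 0 ∉ B i)
    (hA : ∀ i, (A i).card ≤ 2) (hz : ∀ i, z i) (hd : (A 0 ∩ A 2).card ≤ 1) :
    ∃ e f, CycleColors A B D z e f := by
  obtain ⟨g, hg, hm⟩ := exists_sdr_of_pairs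
    ![free (A 0 ∪ A 1), free (A 1 ∪ A 2), free (A 2 ∪ A 3), free (A 3 ∪ A 0)]
    ![3, 3, 3, 3] [(0, 1, 4)]
    (by
      simp only [Fin.forall_fin_succ]
      simp
      refine ⟨?_, ?_, ?_, ?_⟩
      · exact le_card_free (card_union_le_of (hA _) (hA _)) (by norm_num)
      · exact le_card_free (card_union_le_of (hA _) (hA _)) (by norm_num)
      · exact le_card_free (card_union_le_of (hA _) (hA _)) (by norm_num)
      · exact le_card_free (card_union_le_of (hA _) (hA _)) (by norm_num))
    (by
      simp
      refine le_card_free_union (Z := A 1 ∪ (A 0 ∩ A 2)) ?_ (card_union_le_of (hA _) hd)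
        (by norm_num)
      intro k; simp; tauto)
    (by decide)
  simp [Fin.forall_fin_succ, mem_free] at hm
  refine ⟨![g 0, g 1, g 2, g 3], ![0, 0, 0, 0], ?_, ?_, ?_, ?_, ?_, ?_, ?_⟩ <;>
  simp only [Fin.forall_fin_succ] <;> simp [hg.eq_iff, hm, hB0, hz]

theorem exists_cycleColors_lzzz (hB0 : ∀ i, 0 ∉ B i)
    (hA : ∀ i, (A i).card ≤ 2) (h0 : ¬z 0) (h1 : z 1) (h2 : z 2) (h3 : z 3)
    (hl : (A 0).card ≤ 1) (hb : (B 0).card ≤ 3) (hd : (A 1 ∩ A 3).card ≤ 1) :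
    ∃ e f, CycleColors A B D z e f := by
  obtain ⟨g, hg, hm⟩ := exists_sdr_of_pairs
    ![free (A 0 ∪ A 1), free (A 1 ∪ A 2), free (A 2 ∪ A 3), free (A 3 ∪ A 0), free (B 0)]
    ![4, 3, 3, 4, 4] [(0, 3, 5)]
    (by
      simp only [Fin.forall_fin_succ]
      simp
      refine ⟨?_, ?_, ?_, ?_, ?_⟩
      · exact le_card_free (card_union_le_of hl (hA _)) (by norm_num)
      · exact le_card_free (card_union_le_of (hA _) (hA _)) (by norm_num)
      · exact le_card_free (card_union_le_of (hA _) (hA _)) (by norm_num)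
      · exact le_card_free (card_union_le_of (hA _) hl) (by norm_num)
      · exact le_card_free hb (by norm_num))
    (by
      simp
      refine le_card_free_union (Z := A 0 ∪ (A 1 ∩ A 3)) ?_ (card_union_le_of hl hd) (by norm_num)
      intro k; simp; tauto)
    (by decide)
  simp [Fin.forall_fin_succ, mem_free] at hm
  refine ⟨![g 0, g 1, g 2, g 3], ![g 4, 0, 0, 0], ?_, ?_, ?_, ?_, ?_, ?_, ?_⟩ <;>
  simp only [Fin.forall_fin_succ] <;> simp [hg.eq_iff, hm, hB0, h0, h1, h2, h3]

theorem exists_cycleColors_lzlz (hB0 : ∀ i, 0 ∉ B i)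
    (hA : ∀ i, (A i).card ≤ 2) (h0 : ¬z 0) (h1 : z 1) (h2 : ¬z 2) (h3 : z 3)
    (hl0 : (A 0).card ≤ 1) (hl2 : (A 2).card ≤ 1) (hb0 : (B 0).card ≤ 1) (hb2 : (B 2).card ≤ 1) :
    ∃ e f, CycleColors A B D z e f := by
  obtain ⟨g, hg, hm⟩ := exists_sdr_of_pairs
    ![free (A 0 ∪ A 1), free (A 1 ∪ A 2), free (A 2 ∪ A 3), free (A 3 ∪ A 0), free (B 0),
      free (B 2)]
    ![4, 4, 4, 4, 6, 6] []
    (by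
      simp only [Fin.forall_fin_succ]
      simp
      refine ⟨?_, ?_, ?_, ?_, ?_, ?_⟩
      · exact le_card_free (card_union_le_of hl0 (hA _)) (by norm_num)
      · exact le_card_free (card_union_le_of (hA _) hl2) (by norm_num)
      · exact le_card_free (card_union_le_of hl2 (hA _)) (by norm_num)
      · exact le_card_free (card_union_le_of (hA _) hl0) (by norm_num)
      · exact le_card_free hb0 (by norm_num)
      · exact le_card_free hb2 (by norm_num))
    (by simp)
    (by decide)
  simp [Fin.forall_fin_succ, mem_free] at hm
  refine ⟨![g 0, g 1, g 2, g 3], ![g 4, 0, g 5, 0], ?_, ?_, ?_, ?_, ?_, ?_, ?_⟩ <;>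
  simp only [Fin.forall_fin_succ] <;> simp [hg.eq_iff, hm, hB0, h0, h1, h2, h3]

theorem exists_cycleColors_lzlz_of_disjoint (hB0 : ∀ i, 0 ∉ B i)
    (hA : ∀ i, (A i).card ≤ 2) (h0 : ¬z 0) (h1 : z 1) (h2 : ¬z 2) (h3 : z 3)
    (hl0 : (A 0).card ≤ 1) (hl2 : (A 2).card ≤ 1) (hb0 : (B 0).card ≤ 3) (hb2 : (B 2).card ≤ 3)
    (hd : (A 1 ∩ A 3).card ≤ 0) :
    ∃ e f, CycleColors A B D z e f := by
  obtain ⟨g, hg, hm⟩ := exists_sdr_of_pairs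
    ![free (A 0 ∪ A 1), free (A 1 ∪ A 2), free (A 2 ∪ A 3), free (A 3 ∪ A 0), free (B 0),
      free (B 2)]
    ![4, 4, 4, 4, 4, 4] [(0, 3, 6), (1, 2, 6)]
    (by
      simp only [Fin.forall_fin_succ]
      simp
      refine ⟨?_, ?_, ?_, ?_, ?_, ?_⟩
      · exact le_card_free (card_union_le_of hl0 (hA _)) (by norm_num)
      · exact le_card_free (card_union_le_of (hA _) hl2) (by norm_num)
      · exact le_card_free (card_union_le_of hl2 (hA _)) (by norm_num)
      · exact le_card_free (card_union_le_of (hA _) hl0) (by norm_num)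
      · exact le_card_free hb0 (by norm_num)
      · exact le_card_free hb2 (by norm_num))
    (by
      simp
      constructor
      · refine le_card_free_union (Z := A 0 ∪ (A 1 ∩ A 3)) ?_ (card_union_le_of hl0 hd)
          (by norm_num)
        intro k; simp; tauto
      · refine le_card_free_union (Z := A 2 ∪ (A 1 ∩ A 3)) ?_ (card_union_le_of hl2 hd)
          (by norm_num)
        intro k; simp; tauto)
    (by decide)
  simp [Fin.forall_fin_succ, mem_free] at hm
  refine ⟨![g 0, g 1, g 2, g 3], ![g 4, 0, g 5, 0], ?_, ?_, ?_, ?_, ?_, ?_, ?_⟩ <;>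
  simp only [Fin.forall_fin_succ] <;> simp [hg.eq_iff, hm, hB0, h0, h1, h2, h3]

theorem exists_cycleColors_llzz_of_left (hA0 : ∀ i, 0 ∉ A i) (hB0 : ∀ i, 0 ∉ B i)
    (hA : ∀ i, (A i).card ≤ 2) (h0 : ¬z 0) (h1 : ¬z 1) (h2 : z 2) (h3 : z 3)
    (hl0 : (A 0).card ≤ 1) (hl1 : (A 1).card ≤ 1) (hb1 : (B 1).card ≤ 3) (hb0 : (B 0).card ≤ 2) :
    ∃ e f, CycleColors A B D z e f := by
  obtain ⟨g, hg, hm⟩ := exists_sdr_of_pairs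
    ![free (A 1 ∪ A 2), free (A 2 ∪ A 3), free (A 3 ∪ A 0), free (B 0), free (B 1)]
    ![4, 3, 4, 5, 4] []
    (by
      simp only [Fin.forall_fin_succ]
      simp
      refine ⟨?_, ?_, ?_, ?_, ?_⟩
      · exact le_card_free (card_union_le_of hl1 (hA _)) (by norm_num)
      · exact le_card_free (card_union_le_of (hA _) (hA _)) (by norm_num)
      · exact le_card_free (card_union_le_of (hA _) hl0) (by norm_num)
      · exact le_card_free hb0 (by norm_num)
      · exact le_card_free hb1 (by norm_num))
    (by simp)
    (by decide)
  simp [Fin.forall_fin_succ, mem_free] at hm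
  refine ⟨![0, g 0, g 1, g 2], ![g 3, g 4, 0, 0], ?_, ?_, ?_, ?_, ?_, ?_, ?_⟩ <;>
  simp only [Fin.forall_fin_succ] <;> simp [hg.eq_iff, hm, hA0, @eq_comm _ (0 : Fin 8), hB0, h0,
    h1, h2, h3]

theorem exists_cycleColors_llzz_of_right (hA0 : ∀ i, 0 ∉ A i) (hB0 : ∀ i, 0 ∉ B i)
    (hA : ∀ i, (A i).card ≤ 2) (h0 : ¬z 0) (h1 : ¬z 1) (h2 : z 2) (h3 : z 3)
    (hl0 : (A 0).card ≤ 1) (hl1 : (A 1).card ≤ 1) (hb1 : (B 1).card ≤ 3) (hb0 : (B 0).card ≤ 3)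
    (ha2 : (A 2).card ≤ 1) :
    ∃ e f, CycleColors A B D z e f := by
  obtain ⟨g, hg, hm⟩ := exists_sdr_of_pairs
    ![free (A 1 ∪ A 2), free (A 2 ∪ A 3), free (A 3 ∪ A 0), free (B 0), free (B 1)]
    ![5, 4, 4, 4, 4] []
    (by
      simp only [Fin.forall_fin_succ]
      simp
      refine ⟨?_, ?_, ?_, ?_, ?_⟩
      · exact le_card_free (card_union_le_of hl1 ha2) (by norm_num)
      · exact le_card_free (card_union_le_of ha2 (hA _)) (by norm_num)
      · exact le_card_free (card_union_le_of (hA _) hl0) (by norm_num)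
      · exact le_card_free hb0 (by norm_num)
      · exact le_card_free hb1 (by norm_num))
    (by simp)
    (by decide)
  simp [Fin.forall_fin_succ, mem_free] at hm
  refine ⟨![0, g 0, g 1, g 2], ![g 3, g 4, 0, 0], ?_, ?_, ?_, ?_, ?_, ?_, ?_⟩ <;>
  simp only [Fin.forall_fin_succ] <;> simp [hg.eq_iff, hm, hA0, @eq_comm _ (0 : Fin 8), hB0, h0,
    h1, h2, h3]

theorem exists_cycleColors_lllz (hA0 : ∀ i, 0 ∉ A i) (hB0 : ∀ i, 0 ∉ B i)
    (hA : ∀ i, (A i).card ≤ 2) (h0 : ¬z 0) (h1 : ¬z 1) (h2 : ¬z 2) (h3 : z 3)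
    (hl0 : (A 0).card ≤ 1) (hl1 : (A 1).card ≤ 1) (hl2 : (A 2).card ≤ 1)
    (hb0 : (B 0).card ≤ 1) (hb1 : (B 1).card ≤ 3) (hb2 : (B 2).card ≤ 1) :
    ∃ e f, CycleColors A B D z e f := by
  obtain ⟨g, hg, hm⟩ := exists_sdr_of_pairs
    ![free (A 1 ∪ A 2), free (A 2 ∪ A 3), free (A 3 ∪ A 0), free (B 0), free (B 1), free (B 2)]
    ![5, 4, 4, 6, 4, 6] []
    (by
      simp only [Fin.forall_fin_succ]
      simp
      refine ⟨?_, ?_, ?_, ?_, ?_, ?_⟩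
      · exact le_card_free (card_union_le_of hl1 hl2) (by norm_num)
      · exact le_card_free (card_union_le_of hl2 (hA _)) (by norm_num)
      · exact le_card_free (card_union_le_of (hA _) hl0) (by norm_num)
      · exact le_card_free hb0 (by norm_num)
      · exact le_card_free hb1 (by norm_num)
      · exact le_card_free hb2 (by norm_num))
    (by simp)
    (by decide)
  simp [Fin.forall_fin_succ, mem_free] at hm
  refine ⟨![0, g 0, g 1, g 2], ![g 3, g 4, g 5, 0], ?_, ?_, ?_, ?_, ?_, ?_, ?_⟩ <;>
  simp only [Fin.forall_fin_succ] <;> simp [hg.eq_iff, hm, hA0, @eq_comm _ (0 : Fin 8), hB0, h0,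
    h1, h2, h3]

theorem exists_cycleColors_llll (hA0 : ∀ i, 0 ∉ A i)
    (hz : ∀ i, ¬z i) (hA : ∀ i, (A i).card ≤ 1)
    (hB : ∀ i, (B i).card ≤ 1) :
    ∃ e f, CycleColors A B D z e f := by
  obtain ⟨g, hg, hm⟩ := exists_sdr_of_pairs
    ![free (A 1 ∪ A 2), free (A 3 ∪ A 0), free (B 0), free (B 1), free (B 2), free (B 3)]
    ![5, 5, 6, 6, 6, 6] []
    (by
      simp only [Fin.forall_fin_succ]
      simp
      refine ⟨?_, ?_, ?_, ?_, ?_, ?_⟩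
      · exact le_card_free (card_union_le_of (hA _) (hA _)) (by norm_num)
      · exact le_card_free (card_union_le_of (hA _) (hA _)) (by norm_num)
      · exact le_card_free (hB _) (by norm_num)
      · exact le_card_free (hB _) (by norm_num)
      · exact le_card_free (hB _) (by norm_num)
      · exact le_card_free (hB _) (by norm_num))
    (by simp)
    (by decide)
  simp [Fin.forall_fin_succ, mem_free] at hm
  refine ⟨![0, g 0, 0, g 1], ![g 2, g 3, g 4, g 5], ?_, ?_, ?_, ?_, ?_, ?_, ?_⟩ <;>
  simp only [Fin.forall_fin_succ] <;> simp [hg.eq_iff, hm, hA0, @eq_comm _ (0 : Fin 8), hz]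

theorem exists_cycleColors_pinned_zz (hB0 : ∀ i, 0 ∉ B i)
    (hA : ∀ i, (A i).card ≤ 2) {a : Fin 8} (ha : a ≠ 0) (ha0 : a ∉ B 0) (ha2 : a ∉ B 2)
    (h0 : ¬z 0) (h2 : ¬z 2) (hD : D 0 2) (hD' : D 2 0) (h1 : z 1) (h3 : z 3)
    (hd : (A 0 ∩ A 2).card ≤ 0) :
    ∃ e f, CycleColors A B D z e f := by
  obtain ⟨g, hg, hm⟩ := exists_sdr_of_pairs
    ![free (insert a (A 0 ∪ A 1)), free (insert a (A 1 ∪ A 2)), free (insert a (A 2 ∪ A 3)),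
      free (insert a (A 3 ∪ A 0))]
    ![2, 2, 2, 2] [(0, 1, 4), (2, 3, 4)]
    (by
      simp only [Fin.forall_fin_succ]
      simp
      refine ⟨?_, ?_, ?_, ?_⟩
      · exact le_card_free (card_insert_le_of (card_union_le_of (hA _) (hA _))) (by norm_num)
      · exact le_card_free (card_insert_le_of (card_union_le_of (hA _) (hA _))) (by norm_num)
      · exact le_card_free (card_insert_le_of (card_union_le_of (hA _) (hA _))) (by norm_num)
      · exact le_card_free (card_insert_le_of (card_union_le_of (hA _) (hA _))) (by norm_num))
    (by
      simp
      constructor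
      · refine le_card_free_union (Z := insert a (A 1 ∪ (A 0 ∩ A 2))) ?_
          (card_insert_le_of (card_union_le_of (hA _) hd)) (by norm_num)
        intro k; simp; tauto
      · refine le_card_free_union (Z := insert a (A 3 ∪ (A 0 ∩ A 2))) ?_
          (card_insert_le_of (card_union_le_of (hA _) hd)) (by norm_num)
        intro k; simp; tauto)
    (by decide)
  simp [Fin.forall_fin_succ, mem_free] at hm
  refine ⟨![g 0, g 1, g 2, g 3], ![a, 0, a, 0], ?_, ?_, ?_, ?_, ?_, ?_, ?_⟩ <;>
  simp only [Fin.forall_fin_succ] <;> simp [hg.eq_iff, hm, hB0, ha, ha0, ha2, hD, hD', h0, h1,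
    h2, h3]

theorem exists_cycleColors_pinned_lz (hA0 : ∀ i, 0 ∉ A i) (hB0 : ∀ i, 0 ∉ B i)
    (hA : ∀ i, (A i).card ≤ 2) {a : Fin 8} (ha : a ≠ 0) (ha0 : a ∉ B 0) (ha2 : a ∉ B 2)
    (h0 : ¬z 0) (h2 : ¬z 2) (hD : D 0 2) (hD' : D 2 0) (h1 : ¬z 1) (h3 : z 3)
    (hl1 : (A 1).card ≤ 1) (hb1 : (B 1).card ≤ 3) (hd : (A 0 ∩ A 2).card ≤ 0) :
    ∃ e f, CycleColors A B D z e f := by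
  obtain ⟨g, hg, hm⟩ := exists_sdr_of_pairs
    ![free (insert a (A 1 ∪ A 2)), free (insert a (A 2 ∪ A 3)), free (insert a (A 3 ∪ A 0)),
      free (insert a (B 1))]
    ![3, 2, 2, 3] [(1, 2, 4)]
    (by
      simp only [Fin.forall_fin_succ]
      simp
      refine ⟨?_, ?_, ?_, ?_⟩
      · exact le_card_free (card_insert_le_of (card_union_le_of hl1 (hA _))) (by norm_num)
      · exact le_card_free (card_insert_le_of (card_union_le_of (hA _) (hA _))) (by norm_num)
      · exact le_card_free (card_insert_le_of (card_union_le_of (hA _) (hA _))) (by norm_num)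
      · exact le_card_free (card_insert_le_of hb1) (by norm_num))
    (by
      simp
      refine le_card_free_union (Z := insert a (A 3 ∪ (A 0 ∩ A 2))) ?_
        (card_insert_le_of (card_union_le_of (hA _) hd)) (by norm_num)
      intro k; simp; tauto)
    (by decide)
  simp [Fin.forall_fin_succ, mem_free] at hm
  refine ⟨![0, g 0, g 1, g 2], ![a, g 3, a, 0], ?_, ?_, ?_, ?_, ?_, ?_, ?_⟩ <;>
  simp only [Fin.forall_fin_succ] <;> simp [hg.eq_iff, hm, hA0, @eq_comm _ (0 : Fin 8), hB0, ha,
    ha0, ha2, hD, hD', h0, h1, h2, h3, @eq_comm _ a]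

theorem exists_cycleColors_pinned_ll (hA0 : ∀ i, 0 ∉ A i)
    (hA : ∀ i, (A i).card ≤ 2) {a : Fin 8} (ha : a ≠ 0) (ha0 : a ∉ B 0) (ha2 : a ∉ B 2)
    (h0 : ¬z 0) (h2 : ¬z 2) (hD : D 0 2) (hD' : D 2 0) (h1 : ¬z 1) (h3 : ¬z 3)
    (hl1 : (A 1).card ≤ 1) (hb1 : (B 1).card ≤ 3) (hl3 : (A 3).card ≤ 1) (hb3 : (B 3).card ≤ 3)
    (hd : (A 0 ∩ A 2).card ≤ 0) :
    ∃ e f, CycleColors A B D z e f := by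
  obtain ⟨g, hg, hm⟩ := exists_sdr_of_pairs
    ![free (insert a (A 1 ∪ A 2)), free (insert a (A 3 ∪ A 0)), free (insert a (B 1)),
      free (insert a (B 3))]
    ![3, 3, 3, 3] [(0, 1, 4)]
    (by
      simp only [Fin.forall_fin_succ]
      simp
      refine ⟨?_, ?_, ?_, ?_⟩
      · exact le_card_free (card_insert_le_of (card_union_le_of hl1 (hA _))) (by norm_num)
      · exact le_card_free (card_insert_le_of (card_union_le_of hl3 (hA _))) (by norm_num)
      · exact le_card_free (card_insert_le_of hb1) (by norm_num)
      · exact le_card_free (card_insert_le_of hb3) (by norm_num))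
    (by
      simp
      refine le_card_free_union (Z := insert a ((A 1 ∪ A 3) ∪ (A 0 ∩ A 2))) ?_
        (card_insert_le_of (card_union_le_of (card_union_le_of hl1 hl3) hd)) (by norm_num)
      intro k; simp; tauto)
    (by decide)
  simp [Fin.forall_fin_succ, mem_free] at hm
  refine ⟨![0, g 0, 0, g 1], ![a, g 2, a, g 3], ?_, ?_, ?_, ?_, ?_, ?_, ?_⟩ <;>
  simp only [Fin.forall_fin_succ] <;> simp [hg.eq_iff, hm, hA0, @eq_comm _ (0 : Fin 8), ha, ha0,
    ha2, hD, hD', h0, h1, h2, h3, @eq_comm _ a]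

theorem exists_cycleColors_of_disjoint (hB0 : ∀ i, 0 ∉ B i)
    (hA : ∀ i, (A i).card ≤ 2) (hl : ∀ i, ¬z i → (A i).card ≤ 1 ∧ (B i).card ≤ 3)
    (h0 : z 0) (h2 : z 2) (hd : (A 0 ∩ A 2).card ≤ 0) : ∃ e f, CycleColors A B D z e f := by
  have hd' : (A 2 ∩ A 0).card ≤ 0 := by rwa [Finset.inter_comm]
  by_cases h1 : z 1 <;> by_cases h3 : z 3
  · exact exists_cycleColors_zzzz hB0 hA
      (by simp [Fin.forall_fin_succ, h0, h1, h2, h3]) (hd.trans zero_le_one)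
  · exact CycleColors.of_rotate 3 (exists_cycleColors_lzzz (fun _ => hB0 _)
      (fun _ => hA _) h3 h0 h1 h2
      (hl 3 h3).1 (hl 3 h3).2 (hd.trans zero_le_one))
  · exact CycleColors.of_rotate 1 (exists_cycleColors_lzzz (fun _ => hB0 _)
      (fun _ => hA _) h1 h2 h3 h0
      (hl 1 h1).1 (hl 1 h1).2 (hd'.trans zero_le_one))
  · exact CycleColors.of_rotate 1 (exists_cycleColors_lzlz_of_disjoint (fun _ => hB0 _)
      (fun _ => hA _)
      h1 h2 h3 h0 (hl 1 h1).1 (hl 3 h3).1 (hl 1 h1).2 (hl 3 h3).2 hd')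

theorem exists_cycleColors_pinned (hA0 : ∀ i, 0 ∉ A i) (hB0 : ∀ i, 0 ∉ B i)
    (hA : ∀ i, (A i).card ≤ 2) (hl1 : ¬z 1 → (A 1).card ≤ 1 ∧ (B 1).card ≤ 3)
    (hl3 : ¬z 3 → (A 3).card ≤ 1 ∧ (B 3).card ≤ 3) {a : Fin 8} (ha : a ≠ 0) (ha0 : a ∉ B 0)
    (ha2 : a ∉ B 2) (h0 : ¬z 0) (h2 : ¬z 2) (hD : D 0 2) (hD' : D 2 0)
    (hd : (A 0 ∩ A 2).card ≤ 0) : ∃ e f, CycleColors A B D z e f := by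
  by_cases h1 : z 1 <;> by_cases h3 : z 3
  · exact exists_cycleColors_pinned_zz hB0 hA ha ha0 ha2 h0 h2 hD hD' h1 h3 hd
  · exact CycleColors.of_rotate 2 (exists_cycleColors_pinned_lz (fun _ => hA0 _) (fun _ => hB0 _)
      (fun _ => hA _) ha ha2 ha0 h2 h0 hD' hD h3 h1 (hl3 h3).1 (hl3 h3).2
      (show (A 2 ∩ A 0).card ≤ 0 by rwa [Finset.inter_comm]))
  · exact exists_cycleColors_pinned_lz hA0 hB0 hA ha ha0 ha2 h0 h2 hD hD' h1 h3
      (hl1 h1).1 (hl1 h1).2 hd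
  · exact exists_cycleColors_pinned_ll hA0 hA ha ha0 ha2 h0 h2 hD hD' h1 h3
      (hl1 h1).1 (hl1 h1).2 (hl3 h3).1 (hl3 h3).2 hd

theorem exists_cycleColors_llzz (hA0 : ∀ i, 0 ∉ A i) (hB0 : ∀ i, 0 ∉ B i)
    (hA : ∀ i, (A i).card ≤ 2) (hl : ∀ i, ¬z i → (A i).card ≤ 1 ∧ (B i).card ≤ 3)
    (h0 : ¬z 0) (h1 : ¬z 1) (h2 : z 2) (h3 : z 3) (h : (B 0).card ≤ 2 ∨ (A 2).card ≤ 1) :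
    ∃ e f, CycleColors A B D z e f := by
  rcases h with h | h
  · exact exists_cycleColors_llzz_of_left hA0 hB0 hA h0 h1 h2 h3 (hl 0 h0).1 (hl 1 h1).1
      (hl 1 h1).2 h
  · exact exists_cycleColors_llzz_of_right hA0 hB0 hA h0 h1 h2 h3 (hl 0 h0).1 (hl 1 h1).1
      (hl 1 h1).2 (hl 0 h0).2 h

theorem exists_cycleColors_of_diagonals (hA0 : ∀ i, 0 ∉ A i) (hB0 : ∀ i, 0 ∉ B i)
    (hA : ∀ i, (A i).card ≤ 2) (hl : ∀ i, ¬z i → (A i).card ≤ 1 ∧ (B i).card ≤ 3)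
    (hzz : ∀ i, z i → z (i + 2) → (A i ∩ A (i + 2)).card ≤ 1)
    (hlz : ∀ i, ¬z i → z (i + 2) → (B i).card ≤ 2 ∨ (A (i + 2)).card ≤ 1)
    (hll : ∀ i, ¬z i → ¬z (i + 2) → (B i).card ≤ 1) : ∃ e f, CycleColors A B D z e f := by
  have hA0' (k : Fin 4) : ∀ i, 0 ∉ A (i + k) := fun _ => hA0 _
  have hB0' (k : Fin 4) : ∀ i, 0 ∉ B (i + k) := fun _ => hB0 _
  have hA' (k : Fin 4) : ∀ i, (A (i + k)).card ≤ 2 := fun _ => hA _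
  have hl' (k : Fin 4) : ∀ i, ¬z (i + k) → (A (i + k)).card ≤ 1 ∧ (B (i + k)).card ≤ 3 :=
    fun _ => hl _
  by_cases h0 : z 0 <;> by_cases h1 : z 1 <;> by_cases h2 : z 2 <;> by_cases h3 : z 3
  · exact exists_cycleColors_zzzz hB0 hA (by simp [Fin.forall_fin_succ, h0, h1, h2, h3])
      (hzz 0 h0 h2)
  · exact CycleColors.of_rotate 3 (exists_cycleColors_lzzz (hB0' 3) (hA' 3) h3 h0 h1 h2
      (hl 3 h3).1 (hl 3 h3).2 (hzz 0 h0 h2))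
  · exact CycleColors.of_rotate 2 (exists_cycleColors_lzzz (hB0' 2) (hA' 2) h2 h3 h0 h1
      (hl 2 h2).1 (hl 2 h2).2 (hzz 3 h3 h1))
  · exact CycleColors.of_rotate 2 (exists_cycleColors_llzz (hA0' 2) (hB0' 2) (hA' 2)
      (hl' 2) h2 h3 h0 h1
      (hlz 2 h2 h0))
  · exact CycleColors.of_rotate 1 (exists_cycleColors_lzzz (hB0' 1) (hA' 1) h1 h2 h3 h0
      (hl 1 h1).1 (hl 1 h1).2 (hzz 2 h2 h0))
  · exact CycleColors.of_rotate 1 (exists_cycleColors_lzlz (hB0' 1) (hA' 1) h1 h2 h3 h0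
      (hl 1 h1).1 (hl 3 h3).1 (hll 1 h1 h3) (hll 3 h3 h1))
  · exact CycleColors.of_rotate 1 (exists_cycleColors_llzz (hA0' 1) (hB0' 1) (hA' 1)
      (hl' 1) h1 h2 h3 h0
      (hlz 1 h1 h3))
  · exact CycleColors.of_rotate 1 (exists_cycleColors_lllz (hA0' 1) (hB0' 1) (hA' 1) h1 h2 h3 h0
      (hl 1 h1).1 (hl 2 h2).1 (hl 3 h3).1 (hll 1 h1 h3) (hl 2 h2).2 (hll 3 h3 h1))
  · exact exists_cycleColors_lzzz hB0 hA h0 h1 h2 h3 (hl 0 h0).1 (hl 0 h0).2 (hzz 1 h1 h3)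
  · exact CycleColors.of_rotate 3 (exists_cycleColors_llzz (hA0' 3) (hB0' 3) (hA' 3)
      (hl' 3) h3 h0 h1 h2
      (hlz 3 h3 h1))
  · exact exists_cycleColors_lzlz hB0 hA h0 h1 h2 h3
      (hl 0 h0).1 (hl 2 h2).1 (hll 0 h0 h2) (hll 2 h2 h0)
  · exact CycleColors.of_rotate 2 (exists_cycleColors_lllz (hA0' 2) (hB0' 2) (hA' 2) h2 h3 h0 h1
      (hl 2 h2).1 (hl 3 h3).1 (hl 0 h0).1 (hll 2 h2 h0) (hl 3 h3).2 (hll 0 h0 h2))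
  · exact exists_cycleColors_llzz hA0 hB0 hA hl h0 h1 h2 h3 (hlz 0 h0 h2)
  · exact CycleColors.of_rotate 3 (exists_cycleColors_lllz (hA0' 3) (hB0' 3) (hA' 3) h3 h0 h1 h2
      (hl 3 h3).1 (hl 0 h0).1 (hl 1 h1).1 (hll 3 h3 h1) (hl 0 h0).2 (hll 1 h1 h3))
  · exact exists_cycleColors_lllz hA0 hB0 hA h0 h1 h2 h3
      (hl 0 h0).1 (hl 1 h1).1 (hl 2 h2).1 (hll 0 h0 h2) (hl 1 h1).2 (hll 2 h2 h0)
  · have hz : ∀ i, ¬z i := by simp [Fin.forall_fin_succ, h0, h1, h2, h3]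
    exact exists_cycleColors_llll hA0 hz (fun i => (hl i (hz i)).1)
      (fun i => hll i (hz i) (hz _))

end

section
variable {V : Type}

/-- The coloring conditions of a good coloring of `G`, imposed only on the edges in `T`. -/
structure GoodOn (G : SimpleGraph V) (T : Set (Sym2 V)) (c : Sym2 V → Fin 8) : Prop where
  matching : ∀ s ∈ T, ∀ t ∈ T, ∀ v, v ∈ s → v ∈ t → c s = 0 → c t = 0 → s = t
  induced : ∀ s ∈ T, ∀ t ∈ T, ∀ a x, a ∈ s → x ∈ t → a = x ∨ G.Adj a x →
    c s = c t → c s ≠ 0 → s = t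
  degree : ∀ s ∈ T, ∀ v ∈ s, c s = 0 → (G.neighborSet v).ncard = 3

theorem goodColoring_iff_goodOn {G : SimpleGraph V} {c : Sym2 V → Fin 8} :
    GoodColoring G c ↔ GoodOn G G.edgeSet c := by
  constructor
  · rintro ⟨⟨h0, h1⟩, h2⟩
    refine ⟨?_, ?_, ?_⟩
    · intro s hs t ht v
      induction s with | _ a b
      induction t with | _ x y
      intro hv hv' hs0 ht0
      by_contra hne
      have := h0 a b x y hs ht hne hs0 ht0
      simp only [Sym2.mem_iff] at hv hv'
      grind
    · intro s hs t ht p q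
      induction s with | _ a b
      induction t with | _ x y
      intro hp hq hpq hst hs0
      by_contra hne
      have := h1 a b x y hs ht hne hst hs0
      simp only [Sym2.mem_iff] at hp hq
      grind
    · intro s hs v
      induction s with | _ a b
      intro hv hs0
      have := h2 a b hs hs0
      simp only [Sym2.mem_iff] at hv
      grind
  · rintro ⟨h0, h1, h2⟩
    refine ⟨⟨?_, ?_⟩, ?_⟩
    · intro a b x y hs ht hne hs0 ht0
      have key := fun v hv hv' => hne (h0 s(a, b) hs s(x, y) ht v hv hv' hs0 ht0)
      simp only [Sym2.mem_iff] at key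
      grind
    · intro a b x y hs ht hne hst hs0
      have key := fun p q hp hq hpq => hne (h1 s(a, b) hs s(x, y) ht p q hp hq hpq hst hs0)
      simp only [Sym2.mem_iff] at key
      grind
    · intro a b hs hs0
      exact ⟨h2 _ hs a (by simp) hs0, h2 _ hs b (by simp) hs0⟩

theorem neighborSet_eq_of_adj [Finite V] {G : SimpleGraph V} (hG : Subcubic G) {v a b c : V}
    (ha : G.Adj v a) (hb : G.Adj v b) (hc : G.Adj v c) (hab : a ≠ b) (hac : a ≠ c)
    (hbc : b ≠ c) : G.neighborSet v = {a, b, c} := by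
  symm
  refine Set.eq_of_subset_of_ncard_le ?_ ?_
  · rintro x (rfl | rfl | rfl) <;> assumption
  · rw [Set.ncard_eq_three.2 ⟨a, b, c, hab, hac, hbc, rfl⟩]
    exact hG v

/-- The vertices `u 0, u 1, u 2, u 3` form a cycle of length 4, in this order. -/
structure IsFourCycle (G : SimpleGraph V) (u : Fin 4 → V) : Prop where
  inj : Function.Injective u
  adj : ∀ i, G.Adj (u i) (u (i + 1))

/-- The edges of `G` avoiding the vertex set `S`. -/
def edgesOff (G : SimpleGraph V) (S : Set V) : Set (Sym2 V) :=
  {s | s ∈ G.edgeSet ∧ ∀ v ∈ s, v ∉ S}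

/-- The nonzero colors on edges off `S` that meet a neighbor of `v` off `S`. -/
noncomputable def nearPalette (G : SimpleGraph V) (S : Set V) (c : Sym2 V → Fin 8) (v : V) :
    Finset (Fin 8) :=
  open Classical in
  {k | k ≠ 0 ∧ ∃ x y, G.Adj v x ∧ s(x, y) ∈ edgesOff G S ∧ c s(x, y) = k}

/-- The nonzero colors on edges off `S` at distance at most one from a neighbor of `v` off `S`. -/
noncomputable def farPalette (G : SimpleGraph V) (S : Set V) (c : Sym2 V → Fin 8) (v : V) :
    Finset (Fin 8) :=
  open Classical in
  {k | k ≠ 0 ∧ ∃ w x y, w ∉ S ∧ G.Adj v w ∧ (w = x ∨ G.Adj w x) ∧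
    s(x, y) ∈ edgesOff G S ∧ c s(x, y) = k}

theorem mem_nearPalette {G : SimpleGraph V} {S : Set V} {c : Sym2 V → Fin 8} {v : V} {k : Fin 8} :
    k ∈ nearPalette G S c v ↔
      k ≠ 0 ∧ ∃ x y, G.Adj v x ∧ s(x, y) ∈ edgesOff G S ∧ c s(x, y) = k := by
  simp [nearPalette]

theorem mem_farPalette {G : SimpleGraph V} {S : Set V} {c : Sym2 V → Fin 8} {v : V} {k : Fin 8} :
    k ∈ farPalette G S c v ↔ k ≠ 0 ∧ ∃ w x y, w ∉ S ∧ G.Adj v w ∧ (w = x ∨ G.Adj w x) ∧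
      s(x, y) ∈ edgesOff G S ∧ c s(x, y) = k := by
  simp [farPalette]

theorem mem_edgesOff {G : SimpleGraph V} {S : Set V} {x y : V} :
    s(x, y) ∈ edgesOff G S ↔ G.Adj x y ∧ x ∉ S ∧ y ∉ S := by
  simp [edgesOff]

namespace IsFourCycle
variable {G : SimpleGraph V} {u : Fin 4 → V}

theorem adj' (hu : IsFourCycle G u) (i : Fin 4) : G.Adj (u i) (u (i + 3)) := by
  have h := hu.adj (i + 3)
  rw [add_assoc, show (3 : Fin 4) + 1 = 0 from rfl, add_zero] at h
  exact h.symm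

theorem ne (hu : IsFourCycle G u) {i j : Fin 4} (h : i ≠ j) : u i ≠ u j :=
  hu.inj.ne h

theorem rotate (hu : IsFourCycle G u) (k : Fin 4) : IsFourCycle G fun i => u (i + k) where
  inj i j h := add_left_injective k (hu.inj h)
  adj i := by
    have h := hu.adj (i + k)
    rwa [add_right_comm] at h

theorem edge_cases (s : Sym2 V) (hs : s ∈ G.edgeSet) :
    (∃ i, s = s(u i, u (i + 1))) ∨ (∃ i, s = s(u i, u (i + 2))) ∨
      (∃ i v, s = s(u i, v) ∧ v ∉ Set.range u) ∨ s ∈ edgesOff G (Set.range u) := by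
  induction s with | _ a b
  have hne : a ≠ b := G.ne_of_adj hs
  by_cases ha : a ∈ Set.range u <;> by_cases hb : b ∈ Set.range u
  · obtain ⟨i, rfl⟩ := ha
    obtain ⟨j, rfl⟩ := hb
    have hij : i ≠ j := fun h => hne (h ▸ rfl)
    have : j = i + 1 ∨ i = j + 1 ∨ j = i + 2 := by clear hne hs; decide +revert
    rcases this with rfl | rfl | rfl
    · exact Or.inl ⟨i, rfl⟩
    · exact Or.inl ⟨j, Sym2.eq_swap⟩
    · exact Or.inr (Or.inl ⟨i, rfl⟩)
  · obtain ⟨i, rfl⟩ := ha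
    exact Or.inr (Or.inr (Or.inl ⟨i, b, rfl, hb⟩))
  · obtain ⟨i, rfl⟩ := hb
    exact Or.inr (Or.inr (Or.inl ⟨i, a, Sym2.eq_swap, ha⟩))
  · exact Or.inr (Or.inr (Or.inr (mem_edgesOff.2 ⟨hs, ha, hb⟩)))

variable [Finite V]

theorem neighborSet_eq (hu : IsFourCycle G u) (hG : Subcubic G) {i : Fin 4} {v : V}
    (hv : v ∉ Set.range u) (h : G.Adj (u i) v) :
    G.neighborSet (u i) = {u (i + 1), u (i + 3), v} :=
  neighborSet_eq_of_adj hG (hu.adj i) (hu.adj' i) h (hu.ne (by simp))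
    (fun h => hv ⟨_, h⟩) (fun h => hv ⟨_, h⟩)

theorem neighborSet_eq_of_chord (hu : IsFourCycle G u) (hG : Subcubic G) {i : Fin 4}
    (h : G.Adj (u i) (u (i + 2))) :
    G.neighborSet (u i) = {u (i + 1), u (i + 3), u (i + 2)} :=
  neighborSet_eq_of_adj hG (hu.adj i) (hu.adj' i) h (hu.ne (by simp))
    (hu.ne (by simp)) (hu.ne (by simp))

theorem eq_of_adj (hu : IsFourCycle G u) (hG : Subcubic G) {i : Fin 4} {v w : V}
    (hv : v ∉ Set.range u) (hw : w ∉ Set.range u) (h : G.Adj (u i) v) (h' : G.Adj (u i) w) :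
    v = w := by
  have h1 : w ∈ G.neighborSet (u i) := h'
  rw [hu.neighborSet_eq hG hv h] at h1
  rcases h1 with rfl | rfl | rfl
  · exact absurd ⟨_, rfl⟩ hw
  · exact absurd ⟨_, rfl⟩ hw
  · rfl

theorem not_chord (hu : IsFourCycle G u) (hG : Subcubic G) {i : Fin 4} {v : V}
    (hv : v ∉ Set.range u) (h : G.Adj (u i) v) : ¬G.Adj (u i) (u (i + 2)) := by
  intro h'
  have h1 : u (i + 2) ∈ G.neighborSet (u i) := h'
  rw [hu.neighborSet_eq hG hv h] at h1
  rcases h1 with h1 | h1 | h1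
  · exact hu.ne (by simp) h1
  · exact hu.ne (by simp) h1
  · exact hv ⟨_, h1⟩

theorem ncard_neighborSet (hu : IsFourCycle G u) (hG : Subcubic G) {i : Fin 4} {v : V}
    (hv : v ∉ Set.range u) (h : G.Adj (u i) v) : (G.neighborSet (u i)).ncard = 3 :=
  Set.ncard_eq_three.2 ⟨_, _, _, hu.ne (by simp), fun h => hv ⟨_, h⟩,
    fun h => hv ⟨_, h⟩, hu.neighborSet_eq hG hv h⟩

theorem ncard_neighborSet_of_chord (hu : IsFourCycle G u) (hG : Subcubic G) {i : Fin 4}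
    (h : G.Adj (u i) (u (i + 2))) : (G.neighborSet (u i)).ncard = 3 :=
  Set.ncard_eq_three.2 ⟨_, _, _, hu.ne (by simp), hu.ne (by simp),
    hu.ne (by simp), hu.neighborSet_eq_of_chord hG h⟩

end IsFourCycle
end

section
variable {V : Type} {G : SimpleGraph V} {u : Fin 4 → V} {c : Sym2 V → Fin 8}
  {e f : Fin 4 → Fin 8}

open Classical in
/-- The coloring given by `e` on the edges of the cycle `u`, by `f` on the edges leaving it, and
by `c` on the edges off the cycle. Chords get color `0`. -/
noncomputable def extendColoring (u : Fin 4 → V) (c : Sym2 V → Fin 8) (e f : Fin 4 → Fin 8)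
    (s : Sym2 V) : Fin 8 :=
  if h : ∃ i, s = s(u i, u (i + 1)) then e h.choose
  else if ∃ i j, s = s(u i, u j) then 0
  else if h : ∃ i v, s = s(u i, v) then f h.choose
  else c s

theorem IsFourCycle.edge_injective (hu : IsFourCycle G u) {i j : Fin 4}
    (h : s(u i, u (i + 1)) = s(u j, u (j + 1))) : i = j := by
  simp only [Sym2.eq_iff, hu.inj.eq_iff] at h
  decide +revert

theorem IsFourCycle.extendColoring_edge (hu : IsFourCycle G u) (i : Fin 4) :
    extendColoring u c e f s(u i, u (i + 1)) = e i := by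
  have h : ∃ j, s(u i, u (i + 1)) = s(u j, u (j + 1)) := ⟨i, rfl⟩
  rw [extendColoring, dif_pos h, ← hu.edge_injective h.choose_spec]

theorem IsFourCycle.extendColoring_chord (hu : IsFourCycle G u) (i : Fin 4) :
    extendColoring u c e f s(u i, u (i + 2)) = 0 := by
  have h : ¬∃ j, s(u i, u (i + 2)) = s(u j, u (j + 1)) := by
    simp only [Sym2.eq_iff, hu.inj.eq_iff]
    decide +revert
  rw [extendColoring, dif_neg h, if_pos ⟨i, i + 2, rfl⟩]

theorem IsFourCycle.extendColoring_leave (hu : IsFourCycle G u) (i : Fin 4) {v : V}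
    (hv : v ∉ Set.range u) : extendColoring u c e f s(u i, v) = f i := by
  have hv' : ∀ j, u j ≠ v := fun j hj => hv ⟨j, hj⟩
  have h1 : ¬∃ j, s(u i, v) = s(u j, u (j + 1)) := by
    rintro ⟨j, hj⟩
    grind
  have h2 : ¬∃ j k, s(u i, v) = s(u j, u k) := by
    rintro ⟨j, k, hj⟩
    grind
  have h3 : ∃ j w, s(u i, v) = s(u j, w) := ⟨i, v, rfl⟩
  rw [extendColoring, dif_neg h1, if_neg h2, dif_pos h3]
  obtain ⟨w, hw⟩ := h3.choose_spec
  rcases Sym2.eq_iff.1 hw with ⟨h, -⟩ | ⟨-, h⟩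
  · rw [hu.inj h.symm]
  · exact absurd h.symm (hv' _)

theorem extendColoring_off {s : Sym2 V} (hs : s ∈ edgesOff G (Set.range u)) :
    extendColoring u c e f s = c s := by
  have h : ∀ i v, s ≠ s(u i, v) := fun i v h => hs.2 (u i) (h ▸ Sym2.mem_mk_left _ _) ⟨i, rfl⟩
  rw [extendColoring, dif_neg (by simp [h]), if_neg (by simp [h]), dif_neg (by simp [h])]

/-- Colors for the edges meeting a 4-cycle extend a coloring of the edges off the cycle. -/
theorem IsFourCycle.exists_goodColoring [Finite V] (hu : IsFourCycle G u) (hG : Subcubic G)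
    (hc : GoodOn G (edgesOff G (Set.range u)) c) {D : Fin 4 → Fin 4 → Prop} {z : Fin 4 → Prop}
    (h : CycleColors (fun i => nearPalette G (Set.range u) c (u i))
      (fun i => farPalette G (Set.range u) c (u i)) D z e f)
    (hz₀ : ∀ i, ¬z i → ∃ v, v ∉ Set.range u ∧ G.Adj (u i) v)
    (hz₁ : ∀ i v, z i → v ∉ Set.range u → G.Adj (u i) v → (G.neighborSet v).ncard = 3 ∧
      (∀ y, y ∉ Set.range u → G.Adj v y → c s(v, y) ≠ 0) ∧ ∀ j, z j → G.Adj (u j) v → j = i)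
    (hD : ∀ i j, D i j → ¬G.Adj (u i) (u j) ∧ ∀ v w, v ∉ Set.range u → w ∉ Set.range u →
      G.Adj (u i) v → G.Adj (u j) w → v ≠ w ∧ ¬G.Adj v w) :
    ∃ c, GoodColoring G c := by
  refine ⟨extendColoring u c e f, goodColoring_iff_goodOn.2 ?_⟩
  have hE := fun i => hu.extendColoring_edge (c := c) (e := e) (f := f) i
  have hC := fun i => hu.extendColoring_chord (c := c) (e := e) (f := f) i
  have hF := fun i v => hu.extendColoring_leave (c := c) (e := e) (f := f) (v := v) i
  have hO := fun s => extendColoring_off (G := G) (u := u) (c := c) (e := e) (f := f) (s := s)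
  have hchord : ∀ i, G.Adj (u i) (u (i + 2)) → z i := by
    intro i hi
    by_contra hzi
    obtain ⟨v, hv, hv'⟩ := hz₀ i hzi
    exact hu.not_chord hG hv hv' hi
  have hchord' : ∀ i, G.Adj (u i) (u (i + 2)) → z (i + 2) := by
    intro i hi
    refine hchord (i + 2) ?_
    rw [add_assoc, show (2 : Fin 4) + 2 = 0 from rfl, add_zero]
    exact hi.symm
  have h22 : ∀ i : Fin 4, i + 2 + 2 = i := by decide
  -- two edges of color `0` at a vertex of the cycle are equal
  have hcol : ∀ i k, e i = 0 → u k ∈ s(u i, u (i + 1)) → ¬z k := by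
    intro i k hi hk
    have := h.e_zero i hi
    simp only [Sym2.mem_iff, hu.inj.eq_iff] at hk
    rcases hk with rfl | rfl
    exacts [this.1, this.2]
  have hEE : ∀ i j v, e i = 0 → e j = 0 → v ∈ s(u i, u (i + 1)) → v ∈ s(u j, u (j + 1)) →
      i = j := by
    intro i j v hi hj hv hv'
    rcases h.e_inj i j (hi.trans hj.symm) with h' | ⟨-, rfl⟩
    · exact h'
    · simp only [Sym2.mem_iff] at hv hv'
      rcases hv with rfl | rfl <;> simp [hu.inj.eq_iff, add_assoc] at hv'
  have hEC : ∀ i j v, e i = 0 → G.Adj (u j) (u (j + 2)) → v ∈ s(u i, u (i + 1)) →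
      v ∉ s(u j, u (j + 2)) := by
    intro i j v hi hj hv hv'
    rcases Sym2.mem_iff.1 hv' with rfl | rfl
    · exact hcol i _ hi hv (hchord j hj)
    · exact hcol i _ hi hv (hchord' j hj)
  have hEF : ∀ i j v w, e i = 0 → f j = 0 → w ∉ Set.range u → v ∈ s(u i, u (i + 1)) →
      v ∉ s(u j, w) := by
    intro i j v w hi hj hw hv hv'
    rcases Sym2.mem_iff.1 hv' with rfl | rfl
    · exact hcol i _ hi hv ((h.f_zero j).1 hj)
    · rcases Sym2.mem_iff.1 hv with rfl | rfl <;> exact hw ⟨_, rfl⟩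
  have hCF : ∀ i j v w, G.Adj (u i) (u (i + 2)) → G.Adj (u j) w → w ∉ Set.range u →
      v ∈ s(u i, u (i + 2)) → v ∉ s(u j, w) := by
    intro i j v w hi hj hw hv hv'
    have hi' : G.Adj (u (i + 2)) (u (i + 2 + 2)) := by rw [h22]; exact hi.symm
    rcases Sym2.mem_iff.1 hv with rfl | rfl <;> rcases Sym2.mem_iff.1 hv' with h' | rfl
    · exact hu.not_chord hG hw (hu.inj h' ▸ hj) hi
    · exact hw ⟨_, rfl⟩
    · exact hu.not_chord hG hw (hu.inj h' ▸ hj) hi'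
    · exact hw ⟨_, rfl⟩
  have hFO : ∀ i v t x, f i = 0 → G.Adj (u i) v → v ∉ Set.range u →
      t ∈ edgesOff G (Set.range u) → c t = 0 → x ∈ s(u i, v) → x ∉ t := by
    intro i v t x hi hv hv' ht ht0 hx hx'
    rcases Sym2.mem_iff.1 hx with rfl | rfl
    · exact ht.2 _ hx' ⟨_, rfl⟩
    · obtain ⟨y, rfl⟩ := hx'
      have ht' := mem_edgesOff.1 ht
      exact (hz₁ i x ((h.f_zero i).1 hi) hv' hv).2.1 y ht'.2.2 ht'.1 ht0
  have hoff : ∀ i t, t ∈ edgesOff G (Set.range u) → u i ∉ t := fun i t ht hi =>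
    ht.2 _ hi ⟨_, rfl⟩
  have hEO : ∀ i t a x, t ∈ edgesOff G (Set.range u) → a ∈ s(u i, u (i + 1)) → x ∈ t →
      a = x ∨ G.Adj a x → e i = c t → e i = 0 := by
    intro i t a x ht ha hx hax hit
    by_contra h0
    have hA := h.e_avoid i
    simp only [Finset.mem_union, mem_nearPalette, not_or, not_and] at hA
    obtain ⟨y, rfl⟩ := id hx
    rcases Sym2.mem_iff.1 ha with rfl | rfl <;> rcases hax with rfl | hax
    · exact hoff _ _ ht hx
    · exact hA.1 h0 ⟨x, y, hax, ht, hit.symm⟩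
    · exact hoff _ _ ht hx
    · exact hA.2 h0 ⟨x, y, hax, ht, hit.symm⟩
  have hFO' : ∀ i p t a x, p ∉ Set.range u → G.Adj (u i) p → t ∈ edgesOff G (Set.range u) →
      a ∈ s(u i, p) → x ∈ t → a = x ∨ G.Adj a x → f i = c t → f i = 0 := by
    intro i p t a x hp hip ht ha hx hax hit
    by_contra h0
    have hB := h.f_avoid i
    simp only [mem_farPalette, not_and] at hB
    refine hB h0 ?_
    obtain ⟨y, rfl⟩ := id hx
    rcases Sym2.mem_iff.1 ha with rfl | rfl
    · rcases hax with rfl | hax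
      · exact absurd hx (hoff _ _ ht)
      · exact ⟨x, x, y, ht.2 x hx, hax, Or.inl rfl, ht, hit.symm⟩
    · exact ⟨a, x, y, hp, hip, hax, ht, hit.symm⟩
  have hFF : ∀ i j p q a x, p ∉ Set.range u → q ∉ Set.range u → G.Adj (u i) p →
      G.Adj (u j) q → a ∈ s(u i, p) → x ∈ s(u j, q) → a = x ∨ G.Adj a x → ¬D i j := by
    intro i j p q a x hp hq hip hjq ha hx hax hij
    obtain ⟨h1, h2⟩ := hD i j hij
    have h3 := h2 p q hp hq hip hjq
    rcases Sym2.mem_iff.1 ha with rfl | rfl <;> rcases Sym2.mem_iff.1 hx with rfl | rfl <;>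
    rcases hax with hax | hax
    · rw [hax] at hip
      exact h3.1 (hu.eq_of_adj hG hp hq hip hjq)
    · exact h1 hax
    · exact hq ⟨_, hax⟩
    · exact h3.1 (hu.eq_of_adj hG hp hq hip hax)
    · exact hp ⟨_, hax.symm⟩
    · exact h3.1 (hu.eq_of_adj hG hp hq hax.symm hjq)
    · exact h3.1 hax
    · exact h3.2 hax
  refine ⟨?_, ?_, ?_⟩
  · intro s hs t ht v hv hv' hs0 ht0
    rcases edge_cases (u := u) s hs with ⟨i, rfl⟩ | ⟨i, rfl⟩ | ⟨i, p, rfl, hp⟩ | hs' <;>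
    rcases edge_cases (u := u) t ht with ⟨j, rfl⟩ | ⟨j, rfl⟩ | ⟨j, q, rfl, hq⟩ | ht' <;>
    (try simp only [hE, hC] at hs0 ht0) <;> (try simp only [hF _ _ hp] at hs0 ht0) <;>
    (try simp only [hF _ _ hq] at hs0 ht0) <;> (try simp only [hO _ hs'] at hs0 ht0) <;>
    (try simp only [hO _ ht'] at hs0 ht0)
    · rw [hEE i j v hs0 ht0 hv hv']
    · exact absurd hv' (hEC i j v hs0 ht hv)
    · exact absurd hv' (hEF i j v q hs0 ht0 hq hv)
    · rcases Sym2.mem_iff.1 hv with rfl | rfl <;> exact absurd hv' (hoff _ _ ht')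
    · exact absurd hv (hEC j i v ht0 hs hv')
    · simp only [Sym2.mem_iff] at hv hv'
      rcases hv with rfl | rfl <;> simp only [hu.inj.eq_iff] at hv' <;>
      rcases hv' with h' | h'
      · rw [h']
      · rw [h', h22, Sym2.eq_swap]
      · rw [h', Sym2.eq_swap, ← h', h22]
      · rw [add_right_cancel h']
    · exact absurd hv' (hCF i j v q hs ht hq hv)
    · rcases Sym2.mem_iff.1 hv with rfl | rfl <;> exact absurd hv' (hoff _ _ ht')
    · exact absurd hv (hEF j i v p ht0 hs0 hp hv')
    · exact absurd hv (hCF j i v p ht hs hp hv')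
    · have hzi := (h.f_zero i).1 hs0
      have hzj := (h.f_zero j).1 ht0
      rcases Sym2.mem_iff.1 hv with rfl | rfl <;> rcases Sym2.mem_iff.1 hv' with h' | rfl
      · obtain rfl := hu.inj h'
        rw [hu.eq_of_adj hG hp hq hs ht]
      · exact absurd ⟨_, rfl⟩ hq
      · exact absurd ⟨_, h'.symm⟩ hp
      · rw [(hz₁ i v hzi hp hs).2.2 j hzj ht]
    · exact absurd hv' (hFO i p t v hs0 hs hp ht' ht0 hv)
    · rcases Sym2.mem_iff.1 hv' with rfl | rfl <;> exact absurd hv (hoff _ _ hs')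
    · rcases Sym2.mem_iff.1 hv' with rfl | rfl <;> exact absurd hv (hoff _ _ hs')
    · exact absurd hv (hFO j q s v ht0 ht hq hs' hs0 hv')
    · exact hc.matching s hs' t ht' v hv hv' hs0 ht0
  · intro s hs t ht a x ha hx hax hst hs0
    rcases edge_cases (u := u) s hs with ⟨i, rfl⟩ | ⟨i, rfl⟩ | ⟨i, p, rfl, hp⟩ | hs' <;>
    rcases edge_cases (u := u) t ht with ⟨j, rfl⟩ | ⟨j, rfl⟩ | ⟨j, q, rfl, hq⟩ | ht' <;>
    (try simp only [hE, hC] at hst hs0) <;> (try simp only [hF _ _ hp] at hst hs0) <;>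
    (try simp only [hF _ _ hq] at hst hs0) <;> (try simp only [hO _ hs'] at hst hs0) <;>
    (try simp only [hO _ ht'] at hst hs0)
    · rcases h.e_inj i j hst with rfl | ⟨h', -⟩
      · rfl
      · exact absurd h' hs0
    · exact absurd hst hs0
    · exact absurd (h.e_ne_f i j hst) hs0
    · exact absurd (hEO i t a x ht' ha hx hax hst) hs0
    iterate 4 exact absurd rfl hs0
    · exact absurd (hst.trans (h.e_ne_f j i hst.symm)) hs0
    · exact absurd hst hs0
    · rcases h.f_inj i j hst hs0 with rfl | h'
      · rw [hu.eq_of_adj hG hp hq hs ht]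
      · exact absurd h' (hFF i j p q a x hp hq hs ht ha hx hax)
    · exact absurd (hFO' i p t a x hp hs ht' ha hx hax hst) hs0
    · exact absurd (hst.trans (hEO j s x a hs' hx ha
        (hax.imp Eq.symm fun h => h.symm) hst.symm)) hs0
    · exact absurd hst hs0
    · exact absurd (hst.trans (hFO' j q s x a hq ht hs' hx ha
        (hax.imp Eq.symm fun h => h.symm) hst.symm)) hs0
    · exact hc.induced s hs' t ht' a x ha hx hax hst hs0
  · intro s hs v hv hs0
    rcases edge_cases (u := u) s hs with ⟨i, rfl⟩ | ⟨i, rfl⟩ | ⟨i, p, rfl, hp⟩ | hs' <;>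
    (try simp only [hE] at hs0) <;> (try simp only [hF _ _ hp] at hs0) <;>
    (try simp only [hO _ hs'] at hs0)
    · obtain ⟨k, rfl⟩ : ∃ k, u k = v := by
        rcases Sym2.mem_iff.1 hv with rfl | rfl <;> exact ⟨_, rfl⟩
      obtain ⟨w, hw, hw'⟩ := hz₀ k (hcol i k hs0 hv)
      exact hu.ncard_neighborSet hG hw hw'
    · rcases Sym2.mem_iff.1 hv with rfl | rfl
      · exact hu.ncard_neighborSet_of_chord hG hs
      · refine hu.ncard_neighborSet_of_chord hG ?_
        rw [h22]
        exact G.adj_symm hs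
    · rcases Sym2.mem_iff.1 hv with rfl | rfl
      · exact hu.ncard_neighborSet hG hp hs
      · exact (hz₁ i v ((h.f_zero i).1 hs0) hp hs).1
    · exact hc.degree s hs' v hv hs0
end

section
variable {V : Type} {G : SimpleGraph V} {u : Fin 4 → V} {c : Sym2 V → Fin 8}

/-- The edge leaving `u i`, if any, ends at a vertex of degree 3 and no earlier vertex of `u` is
adjacent to that vertex. -/
def CanLeaveZero (G : SimpleGraph V) (u : Fin 4 → V) (i : Fin 4) : Prop :=
  ∀ v, v ∉ Set.range u → G.Adj (u i) v → (G.neighborSet v).ncard = 3 ∧ ∀ j < i, ¬G.Adj (u j) v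

theorem CanLeaveZero.eq_of_adj {i j : Fin 4} {v : V} (hi : CanLeaveZero G u i)
    (hj : CanLeaveZero G u j) (hv : v ∉ Set.range u) (hiv : G.Adj (u i) v) (hjv : G.Adj (u j) v) :
    j = i := by
  rcases lt_trichotomy i j with h | h | h
  · exact absurd hiv ((hj v hv hjv).2 i h)
  · exact h.symm
  · exact absurd hjv ((hi v hv hiv).2 j h)

/-- The number of neighbors of `v` off the cycle `u`. -/
noncomputable def offDegree (G : SimpleGraph V) (u : Fin 4 → V) (v : V) : ℕ :=
  (G.neighborSet v \ Set.range u).ncard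

theorem zero_notMem_nearPalette {S : Set V} {v : V} : 0 ∉ nearPalette G S c v := by
  simp [mem_nearPalette]

theorem zero_notMem_farPalette {S : Set V} {v : V} : 0 ∉ farPalette G S c v := by
  simp [mem_farPalette]

theorem nearPalette_eq_empty {S : Set V} {x : V} (h : ∀ v, v ∉ S → ¬G.Adj x v) :
    nearPalette G S c x = ∅ := by
  refine Finset.eq_empty_of_forall_notMem fun k hk => ?_
  obtain ⟨-, v, y, hv, hvy, -⟩ := mem_nearPalette.1 hk
  exact h v (mem_edgesOff.1 hvy).2.1 hv

/-- The graph obtained from `G` by removing all edges meeting `S` and adding an edge between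
`p` and `q` when these are distinct vertices off `S`. -/
def reducedGraph (G : SimpleGraph V) (S : Set V) (p q : V) : SimpleGraph V where
  Adj x y := x ∉ S ∧ y ∉ S ∧ (G.Adj x y ∨ x ≠ y ∧ s(x, y) = s(p, q))
  symm := ⟨fun _ _ h => ⟨h.2.1, h.1, h.2.2.imp G.adj_symm fun h =>
    ⟨h.1.symm, Sym2.eq_swap.trans h.2⟩⟩⟩
  loopless := ⟨fun _ h => h.2.2.elim G.irrefl fun h => h.1 rfl⟩

theorem edgesOff_subset_reducedGraph {S : Set V} {p q : V} :
    edgesOff G S ⊆ (reducedGraph G S p q).edgeSet := by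
  intro s hs
  induction s with | _ x y
  have hs := mem_edgesOff.1 hs
  exact ⟨hs.2.1, hs.2.2, Or.inl hs.1⟩

variable [Finite V]

theorem card_le_ncard_of_forall_exists {s : Finset (Fin 8)} {T : Set V} (g : V → Fin 8)
    (h : ∀ k ∈ s, ∃ y ∈ T, g y = k) : s.card ≤ T.ncard := by
  rw [← Set.ncard_coe_finset]
  exact (Set.ncard_le_ncard (t := g '' T) h).trans (Set.ncard_image_le T.toFinite)

theorem offDegree_le_three (hG : Subcubic G) (v : V) : offDegree G u v ≤ 3 :=
  (Set.ncard_le_ncard Set.sdiff_subset).trans (hG v)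

namespace IsFourCycle

theorem offDegree_add_card_le (hu : IsFourCycle G u) {v : V} (T : Finset (Fin 4))
    (hT : ∀ j ∈ T, G.Adj (u j) v) : offDegree G u v + T.card ≤ (G.neighborSet v).ncard := by
  have h : T.card ≤ (G.neighborSet v ∩ Set.range u).ncard := by
    rw [← Set.ncard_coe_finset, ← Set.ncard_image_of_injective _ hu.inj]
    refine Set.ncard_le_ncard ?_
    rintro _ ⟨j, hj, rfl⟩
    exact ⟨(hT j hj).symm, j, rfl⟩
  have := Set.ncard_inter_add_ncard_sdiff_eq_ncard (G.neighborSet v) (Set.range u)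
  rw [offDegree]
  omega

theorem offDegree_lt (hu : IsFourCycle G u) {i : Fin 4} {v : V} (h : G.Adj (u i) v) :
    offDegree G u v < (G.neighborSet v).ncard := by
  simpa using hu.offDegree_add_card_le {i} (by simpa using h)

theorem offDegree_le_two (hu : IsFourCycle G u) (hG : Subcubic G) {i : Fin 4} {v : V}
    (h : G.Adj (u i) v) : offDegree G u v ≤ 2 := by
  have := hu.offDegree_lt h
  have := hG v
  omega

theorem offDegree_le_one (hu : IsFourCycle G u) (hG : Subcubic G) {i j : Fin 4} {v : V}
    (hij : i ≠ j) (h : G.Adj (u i) v) (h' : G.Adj (u j) v) : offDegree G u v ≤ 1 := by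
  have := hu.offDegree_add_card_le {i, j} (by simpa using ⟨h, h'⟩)
  have := hG v
  rw [Finset.card_pair hij] at *
  omega

theorem exists_of_not_canLeaveZero (hu : IsFourCycle G u) (hG : Subcubic G) {i : Fin 4}
    (h : ¬CanLeaveZero G u i) : ∃ v, v ∉ Set.range u ∧ G.Adj (u i) v ∧ offDegree G u v ≤ 1 := by
  simp only [CanLeaveZero, not_forall, Classical.not_and_iff_not_or_not, not_not] at h
  obtain ⟨v, hv, hiv, h⟩ := h
  refine ⟨v, hv, hiv, ?_⟩
  rcases h with h | ⟨j, hj, h⟩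
  · have := hu.offDegree_lt hiv
    have := hG v
    omega
  · exact hu.offDegree_le_one hG hj.ne h hiv

theorem exists_adj_of_mem_nearPalette (hu : IsFourCycle G u) (hG : Subcubic G) {i : Fin 4} {v : V}
    (hv : v ∉ Set.range u) (hiv : G.Adj (u i) v) {k : Fin 8}
    (hk : k ∈ nearPalette G (Set.range u) c (u i)) :
    k ≠ 0 ∧ ∃ y, s(v, y) ∈ edgesOff G (Set.range u) ∧ c s(v, y) = k := by
  obtain ⟨h0, x, y, hx, hxy, hk⟩ := mem_nearPalette.1 hk
  obtain rfl := hu.eq_of_adj hG hv (mem_edgesOff.1 hxy).2.1 hiv hx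
  exact ⟨h0, y, hxy, hk⟩

theorem card_nearPalette_le (hu : IsFourCycle G u) (hG : Subcubic G) {i : Fin 4} {v : V}
    (hv : v ∉ Set.range u) (hiv : G.Adj (u i) v) :
    (nearPalette G (Set.range u) c (u i)).card ≤ offDegree G u v := by
  refine card_le_ncard_of_forall_exists (fun y => c s(v, y)) fun k hk => ?_
  obtain ⟨-, y, hy, hk⟩ := hu.exists_adj_of_mem_nearPalette hG hv hiv hk
  have hy := mem_edgesOff.1 hy
  exact ⟨y, ⟨hy.1, hy.2.2⟩, hk⟩

theorem card_nearPalette_le_two (hu : IsFourCycle G u) (hG : Subcubic G) (i : Fin 4) :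
    (nearPalette G (Set.range u) c (u i)).card ≤ 2 := by
  by_cases h : ∃ v, v ∉ Set.range u ∧ G.Adj (u i) v
  · obtain ⟨v, hv, hiv⟩ := h
    exact (hu.card_nearPalette_le hG hv hiv).trans (hu.offDegree_le_two hG hiv)
  · push Not at h
    simp [nearPalette_eq_empty h]

theorem card_farPalette_le (hu : IsFourCycle G u) (hG : Subcubic G) {i : Fin 4} {v x : V}
    (hv : v ∉ Set.range u) (hiv : G.Adj (u i) v)
    (hx : ∀ y, y ∉ Set.range u → G.Adj v y → y = x) :
    (farPalette G (Set.range u) c (u i)).card ≤ offDegree G u x := by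
  refine card_le_ncard_of_forall_exists (fun y => c s(x, y)) fun k hk => ?_
  obtain ⟨-, w, a, b, hw, hiw, hwa, hab, hk⟩ := mem_farPalette.1 hk
  obtain rfl := hu.eq_of_adj hG hv hw hiv hiw
  have hab := mem_edgesOff.1 hab
  rcases hwa with rfl | hwa
  · obtain rfl := hx b hab.2.2 hab.1
    exact ⟨v, ⟨hab.1.symm, hab.2.1⟩, by rw [← hk, Sym2.eq_swap]⟩
  · obtain rfl := hx a hab.2.1 hwa
    exact ⟨b, ⟨hab.1, hab.2.2⟩, hk⟩

theorem card_farPalette_eq_zero (hu : IsFourCycle G u) (hG : Subcubic G) {i : Fin 4} {v : V}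
    (hv : v ∉ Set.range u) (hiv : G.Adj (u i) v) (h : offDegree G u v = 0) :
    (farPalette G (Set.range u) c (u i)).card = 0 := by
  rw [offDegree, Set.ncard_eq_zero] at h
  have h' : ∀ y, y ∉ Set.range u → ¬G.Adj v y := fun y hy hvy =>
    Set.notMem_empty y (h ▸ ⟨hvy, hy⟩)
  refine Finset.card_eq_zero.2 (Finset.eq_empty_of_forall_notMem fun k hk => ?_)
  obtain ⟨-, w, a, b, hw, hiw, hwa, hab, -⟩ := mem_farPalette.1 hk
  obtain rfl := hu.eq_of_adj hG hv hw hiv hiw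
  have hab := mem_edgesOff.1 hab
  rcases hwa with rfl | hwa
  · exact h' b hab.2.2 hab.1
  · exact h' a hab.2.1 hwa

theorem eq_of_offDegree_le_one {v x y : V} (h : offDegree G u v ≤ 1)
    (hx : x ∉ Set.range u) (hvx : G.Adj v x) (hy : y ∉ Set.range u) (hvy : G.Adj v y) : y = x :=
  (Set.ncard_le_one (Set.toFinite _)).1 h y ⟨hvy, hy⟩ x ⟨hvx, hx⟩

theorem card_le_of_not_canLeaveZero (hu : IsFourCycle G u) (hG : Subcubic G) {i : Fin 4}
    (h : ¬CanLeaveZero G u i) : (nearPalette G (Set.range u) c (u i)).card ≤ 1 ∧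
      (farPalette G (Set.range u) c (u i)).card ≤ 3 := by
  obtain ⟨v, hv, hiv, h1⟩ := hu.exists_of_not_canLeaveZero hG h
  refine ⟨(hu.card_nearPalette_le hG hv hiv).trans h1, ?_⟩
  by_cases hx : ∃ x, x ∉ Set.range u ∧ G.Adj v x
  · obtain ⟨x, hx, hvx⟩ := hx
    exact (hu.card_farPalette_le hG hv hiv fun y hy hvy =>
      eq_of_offDegree_le_one h1 hx hvx hy hvy).trans (offDegree_le_three hG x)
  · exact (hu.card_farPalette_le hG (x := v) hv hiv fun y hy hvy =>
      absurd ⟨y, hy, hvy⟩ hx).trans (offDegree_le_three hG v)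

end IsFourCycle

theorem ncard_neighborSet_reducedGraph_le_offDegree (v p q : V) :
    ((reducedGraph G (Set.range u) p q).neighborSet v).ncard ≤ offDegree G u v + 1 := by
  classical
  refine (Set.ncard_le_ncard (t := insert (if v = p then q else p)
    (G.neighborSet v \ Set.range u)) ?_).trans (Set.ncard_insert_le _ _)
  rintro y ⟨-, hy, h | ⟨hne, h⟩⟩
  · exact Or.inr ⟨h, hy⟩
  · left
    rcases Sym2.eq_iff.1 h with ⟨rfl, rfl⟩ | ⟨rfl, rfl⟩
    · simp
    · simp [hne]

theorem ncard_neighborSet_reducedGraph_le_of_ne {v p q : V} (h : p ≠ q → v ≠ p ∧ v ≠ q) :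
    ((reducedGraph G (Set.range u) p q).neighborSet v).ncard ≤ offDegree G u v := by
  refine Set.ncard_le_ncard ?_
  rintro y ⟨-, hy, h' | ⟨hne, h'⟩⟩
  · exact ⟨h', hy⟩
  · rcases Sym2.eq_iff.1 h' with ⟨rfl, rfl⟩ | ⟨rfl, rfl⟩
    · exact absurd rfl (h hne).1
    · exact absurd rfl (h hne.symm).2

namespace IsFourCycle

/-- Adding an edge between two neighbors of the cycle does not increase degrees. -/
theorem ncard_neighborSet_reducedGraph_le_ncard (hu : IsFourCycle G u) {p q : V}
    (h : p ≠ q → (∃ i, G.Adj (u i) p) ∧ ∃ i, G.Adj (u i) q) (v : V) :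
    ((reducedGraph G (Set.range u) p q).neighborSet v).ncard ≤ (G.neighborSet v).ncard := by
  by_cases h' : p ≠ q → v ≠ p ∧ v ≠ q
  · exact (ncard_neighborSet_reducedGraph_le_of_ne h').trans (Set.ncard_le_ncard Set.sdiff_subset)
  · obtain ⟨i, hi⟩ : ∃ i, G.Adj (u i) v := by grind
    exact (ncard_neighborSet_reducedGraph_le_offDegree v p q).trans (hu.offDegree_lt hi)

theorem ncard_edgeSet_reducedGraph_lt (hu : IsFourCycle G u) (p q : V) :
    (reducedGraph G (Set.range u) p q).edgeSet.ncard < G.edgeSet.ncard := by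
  have h01 : s(u 0, u 1) ∈ G.edgeSet := hu.adj 0
  have h12 : s(u 1, u 2) ∈ G.edgeSet := hu.adj 1
  have hne : s(u 1, u 2) ≠ s(u 0, u 1) := fun h => by
    simpa using hu.edge_injective (i := 1) (j := 0) h
  have hsub : (reducedGraph G (Set.range u) p q).edgeSet ⊆
      insert s(p, q) ((G.edgeSet \ {s(u 0, u 1)}) \ {s(u 1, u 2)}) := by
    intro s
    induction s with | _ x y
    rintro ⟨hx, hy, h | h⟩
    · refine Or.inr ⟨⟨h, ?_⟩, ?_⟩ <;> intro h' <;>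
      rcases Sym2.eq_iff.1 h' with ⟨rfl, rfl⟩ | ⟨rfl, rfl⟩ <;> exact hx ⟨_, rfl⟩
    · exact Or.inl h.2
  have h1 := (Set.ncard_le_ncard hsub).trans (Set.ncard_insert_le _ _)
  have h2 := Set.ncard_sdiff_singleton_lt_of_mem h01
  have h3 := Set.ncard_sdiff_singleton_lt_of_mem
    (show s(u 1, u 2) ∈ G.edgeSet \ {s(u 0, u 1)} from ⟨h12, hne⟩)
  omega

theorem exists_goodOn_reducedGraph (hu : IsFourCycle G u) (hG : MinCounter V G) {p q : V}
    (h : p ≠ q → (∃ i, G.Adj (u i) p) ∧ ∃ i, G.Adj (u i) q) :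
    ∃ c, GoodOn (reducedGraph G (Set.range u) p q)
      (reducedGraph G (Set.range u) p q).edgeSet c := by
  obtain ⟨c, hc⟩ := hG.2.2 V (reducedGraph G (Set.range u) p q)
    (fun v => (hu.ncard_neighborSet_reducedGraph_le_ncard h v).trans (hG.1 v))
    (Nat.add_lt_add_left (hu.ncard_edgeSet_reducedGraph_lt p q) _)
  exact ⟨c, goodColoring_iff_goodOn.1 hc⟩

theorem goodOn_edgesOff (hu : IsFourCycle G u) (hG : Subcubic G) {p q : V}
    (h : p ≠ q → (∃ i, G.Adj (u i) p) ∧ ∃ i, G.Adj (u i) q)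
    (hc : GoodOn (reducedGraph G (Set.range u) p q)
      (reducedGraph G (Set.range u) p q).edgeSet c) : GoodOn G (edgesOff G (Set.range u)) c where
  matching s hs t ht := hc.matching s (edgesOff_subset_reducedGraph hs) t
    (edgesOff_subset_reducedGraph ht)
  induced s hs t ht a x ha hx hax := hc.induced s (edgesOff_subset_reducedGraph hs) t
    (edgesOff_subset_reducedGraph ht) a x ha hx
    (hax.imp_right fun hax => ⟨hs.2 a ha, ht.2 x hx, Or.inl hax⟩)
  degree s hs v hv h0 := le_antisymm (hG v)
    ((hc.degree s (edgesOff_subset_reducedGraph hs) v hv h0).ge.trans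
      (hu.ncard_neighborSet_reducedGraph_le_ncard h v))

/-- In a good coloring of the reduced graph, edges off the cycle at a neighbor `v` of the cycle
have nonzero colors unless `v` is an endpoint of the added edge. -/
theorem color_ne_zero (hu : IsFourCycle G u) (hG : Subcubic G) {p q : V}
    (hc : GoodOn (reducedGraph G (Set.range u) p q)
      (reducedGraph G (Set.range u) p q).edgeSet c) {i : Fin 4} {v y : V}
    (hiv : G.Adj (u i) v) (h : p ≠ q → v = p ∨ v = q → ∃ j, i ≠ j ∧ G.Adj (u j) v)
    (hv : v ∉ Set.range u) (hy : y ∉ Set.range u) (hvy : G.Adj v y) : c s(v, y) ≠ 0 := by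
  intro h0
  have h3 := hc.degree s(v, y) (edgesOff_subset_reducedGraph (mem_edgesOff.2 ⟨hvy, hv, hy⟩)) v
    (Sym2.mem_mk_left _ _) h0
  by_cases h' : p ≠ q → v ≠ p ∧ v ≠ q
  · have := ncard_neighborSet_reducedGraph_le_of_ne (G := G) (u := u) h'
    have := hu.offDegree_le_two hG hiv
    omega
  · obtain ⟨j, hij, hj⟩ : ∃ j, i ≠ j ∧ G.Adj (u j) v := by grind
    have := ncard_neighborSet_reducedGraph_le_offDegree (G := G) (u := u) v p q
    have := hu.offDegree_le_one hG hij hiv hj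
    omega

end IsFourCycle
end

section
variable {V : Type} {G : SimpleGraph V}

theorem SimpleGraph.Walk.IsCycle.isFourCycle {v : V} {w : G.Walk v v} (hw : w.IsCycle)
    (hl : w.length = 4) : IsFourCycle G fun i : Fin 4 => w.getVert i where
  inj i j h := Fin.ext (hw.getVert_injOn' (by simp [hl]; omega) (by simp [hl]; omega) h)
  adj i := by
    have h := w.adj_getVert_succ (i := i) (by omega)
    have h4 : w.getVert 4 = w.getVert 0 := by rw [← hl, w.getVert_length, w.getVert_zero]
    fin_cases i
    · exact h
    · exact h
    · exact h
    · exact h4 ▸ h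

variable [Finite V] {u : Fin 4 → V}

/-- If opposite edges leaving the cycle always end at equal or adjacent vertices, then every good
coloring of the graph without the cycle extends. -/
theorem IsFourCycle.exists_goodColoring_of_diagonals (hu : IsFourCycle G u) (hG : MinCounter V G)
    (hd : ∀ i v w, v ∉ Set.range u → w ∉ Set.range u → G.Adj (u i) v → G.Adj (u (i + 2)) w →
      v = w ∨ G.Adj v w) : ∃ c, GoodColoring G c := by
  have hG' := hG.1
  obtain ⟨c, hc⟩ := hu.exists_goodOn_reducedGraph hG (p := u 0) (q := u 0) (absurd rfl)
  have hcG := hu.goodOn_edgesOff hG' (absurd rfl) hc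
  have h2 : ∀ i : Fin 4, i ≠ i + 2 := by decide
  have h : ∃ e f, CycleColors (fun i => nearPalette G (Set.range u) c (u i))
      (fun i => farPalette G (Set.range u) c (u i)) (fun _ _ => False) (CanLeaveZero G u) e f := by
    refine exists_cycleColors_of_diagonals (fun _ => zero_notMem_nearPalette)
      (fun _ => zero_notMem_farPalette) (hu.card_nearPalette_le_two hG')
      (fun i => hu.card_le_of_not_canLeaveZero hG') ?_ ?_ ?_
    · intro i _ _
      by_cases hi : ∃ v, v ∉ Set.range u ∧ G.Adj (u i) v
      swap
      · simp [nearPalette_eq_empty fun v hv hiv => hi ⟨v, hv, hiv⟩]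
      by_cases hj : ∃ w, w ∉ Set.range u ∧ G.Adj (u (i + 2)) w
      swap
      · simp [nearPalette_eq_empty fun v hv hiv => hj ⟨v, hv, hiv⟩]
      obtain ⟨v, hv, hiv⟩ := hi
      obtain ⟨w, hw, hjw⟩ := hj
      rcases hd i v w hv hw hiv hjw with rfl | hvw
      · exact (Finset.card_le_card Finset.inter_subset_left).trans
          ((hu.card_nearPalette_le hG' hv hiv).trans (hu.offDegree_le_one hG' (h2 i) hiv hjw))
      · refine Finset.card_le_one_iff_subset_singleton.2 ⟨c s(v, w), fun k hk => ?_⟩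
        obtain ⟨hk, hk'⟩ := Finset.mem_inter.1 hk
        obtain ⟨h0, y, hy, rfl⟩ := hu.exists_adj_of_mem_nearPalette hG' hv hiv hk
        obtain ⟨-, y', hy', hyy⟩ := hu.exists_adj_of_mem_nearPalette hG' hw hjw hk'
        have := hcG.induced _ hy _ hy' v w (Sym2.mem_mk_left _ _) (Sym2.mem_mk_left _ _)
          (Or.inr hvw) hyy.symm h0
        rcases Sym2.eq_iff.1 this with ⟨rfl, -⟩ | ⟨-, rfl⟩
        · exact absurd hvw G.irrefl
        · exact Finset.mem_singleton_self _
    · intro i hi _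
      obtain ⟨v, hv, hiv, h1⟩ := hu.exists_of_not_canLeaveZero hG' hi
      by_cases hj : ∃ w, w ∉ Set.range u ∧ G.Adj (u (i + 2)) w
      swap
      · right
        simp [nearPalette_eq_empty fun v hv hiv => hj ⟨v, hv, hiv⟩]
      obtain ⟨w, hw, hjw⟩ := hj
      rcases hd i v w hv hw hiv hjw with rfl | hvw
      · exact Or.inr ((hu.card_nearPalette_le hG' hv hjw).trans h1)
      · exact Or.inl ((hu.card_farPalette_le hG' hv hiv fun y hy hvy =>
          eq_of_offDegree_le_one h1 hw hvw hy hvy).trans (hu.offDegree_le_two hG' hjw))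
    · intro i hi hj
      obtain ⟨v, hv, hiv, h1⟩ := hu.exists_of_not_canLeaveZero hG' hi
      obtain ⟨w, hw, hjw, h1'⟩ := hu.exists_of_not_canLeaveZero hG' hj
      rcases hd i v w hv hw hiv hjw with rfl | hvw
      · refine (hu.card_farPalette_eq_zero hG' hv hiv ?_).le.trans zero_le_one
        by_cases h3 : (G.neighborSet v).ncard = 3
        · have key : ∀ j, ¬CanLeaveZero G u j → G.Adj (u j) v → ∃ k < j, G.Adj (u k) v := by
            intro j hj hjv
            by_contra! hk
            refine hj fun v' hv' hjv' => ?_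
            obtain rfl := hu.eq_of_adj hG' hv hv' hjv hjv'
            exact ⟨h3, hk⟩
          obtain ⟨k, hk, hkv⟩ := key i hi hiv
          obtain ⟨l, hl, hlv⟩ := key _ hj hjw
          obtain ⟨m, hmv, hmi, hmj⟩ : ∃ m, G.Adj (u m) v ∧ m ≠ i ∧ m ≠ i + 2 := by
            have : (k ≠ i ∧ k ≠ i + 2) ∨ (l ≠ i ∧ l ≠ i + 2) := by
              clear * - hk hl
              decide +revert
            rcases this with h | h
            exacts [⟨k, hkv, h⟩, ⟨l, hlv, h⟩]
          have := hu.offDegree_add_card_le {m, i, i + 2} (by simpa using ⟨hmv, hiv, hjw⟩)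
          rw [Finset.card_eq_three.2 ⟨m, i, i + 2, hmi, hmj, h2 i, rfl⟩] at this
          omega
        · have := hu.offDegree_add_card_le {i, i + 2} (by simpa using ⟨hiv, hjw⟩)
          have := hG' v
          rw [Finset.card_pair (h2 i)] at *
          omega
      · exact (hu.card_farPalette_le hG' hv hiv fun y hy hvy =>
          eq_of_offDegree_le_one h1 hw hvw hy hvy).trans h1'
  obtain ⟨e, f, h⟩ := h
  refine hu.exists_goodColoring hG' hcG h ?_ ?_ (fun _ _ => False.elim)
  · intro i hi
    obtain ⟨v, hv, hiv, -⟩ := hu.exists_of_not_canLeaveZero hG' hi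
    exact ⟨v, hv, hiv⟩
  · intro i v hi hv hiv
    exact ⟨(hi v hv hiv).1, fun y hy hvy => hu.color_ne_zero hG' hc hiv (absurd rfl) hv hy hvy,
      fun j hj hjv => hi.eq_of_adj hj hv hiv hjv⟩

/-- If opposite edges leaving the cycle end at distinct nonadjacent vertices, then every good
coloring of the graph without the cycle, but with an edge joining those vertices, extends. -/
theorem IsFourCycle.exists_goodColoring_of_not_adj (hu : IsFourCycle G u) (hG : MinCounter V G)
    {p q : V} (hp : p ∉ Set.range u) (hq : q ∉ Set.range u) (hup : G.Adj (u 0) p)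
    (huq : G.Adj (u 2) q) (hpq : p ≠ q) (hnpq : ¬G.Adj p q) : ∃ c, GoodColoring G c := by
  have hG' := hG.1
  have hadj : p ≠ q → (∃ i, G.Adj (u i) p) ∧ ∃ i, G.Adj (u i) q := fun _ => ⟨⟨0, hup⟩, 2, huq⟩
  obtain ⟨c, hc⟩ := hu.exists_goodOn_reducedGraph hG hadj
  have hcG := hu.goodOn_edgesOff hG' hadj hc
  have hpqH : (reducedGraph G (Set.range u) p q).Adj p q := ⟨hp, hq, Or.inr ⟨hpq, rfl⟩⟩
  have hoff : s(p, q) ∉ edgesOff G (Set.range u) := fun h => hnpq (mem_edgesOff.1 h).1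
  have hsub : ∀ s ∈ edgesOff G (Set.range u), s ∈ (reducedGraph G (Set.range u) p q).edgeSet :=
    edgesOff_subset_reducedGraph
  have hd : (nearPalette G (Set.range u) c (u 0) ∩ nearPalette G (Set.range u) c
    (u 2)).card ≤ 0 := by
    refine (Finset.card_eq_zero.2 (Finset.eq_empty_of_forall_notMem fun k hk => ?_)).le
    obtain ⟨hk, hk'⟩ := Finset.mem_inter.1 hk
    obtain ⟨h0, y, hy, rfl⟩ := hu.exists_adj_of_mem_nearPalette hG' hp hup hk
    obtain ⟨-, y', hy', hyy⟩ := hu.exists_adj_of_mem_nearPalette hG' hq huq hk'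
    have := hc.induced _ (hsub _ hy) _ (hsub _ hy') p q (Sym2.mem_mk_left _ _)
      (Sym2.mem_mk_left _ _) (Or.inr hpqH) hyy.symm h0
    rcases Sym2.eq_iff.1 this with ⟨h, -⟩ | ⟨-, rfl⟩
    · exact hpq h
    · exact hoff hy
  -- the only neighbors of `p` and `q` on the cycle are `u 0` and `u 2` if `p` and `q` have
  -- degree 3 in the reduced graph
  have honly : ∀ i v, G.Adj (u i) v → ((reducedGraph G (Set.range u) p q).neighborSet v).ncard = 3 →
      ∀ j, i ≠ j → ¬G.Adj (u j) v := by
    intro i v hiv h3 j hij hjv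
    have := ncard_neighborSet_reducedGraph_le_offDegree (G := G) (u := u) v p q
    have := hu.offDegree_le_one hG' hij hiv hjv
    omega
  by_cases hα : c s(p, q) = 0
  · have hz : ∀ i v, v ∉ Set.range u → G.Adj (u i) v → v ∈ s(p, q) → CanLeaveZero G u i := by
      intro i v hv hiv hvpq w hw hiw
      obtain rfl := hu.eq_of_adj hG' hv hw hiv hiw
      have h3 := hc.degree _ hpqH v hvpq hα
      exact ⟨le_antisymm (hG' v) (h3.ge.trans (hu.ncard_neighborSet_reducedGraph_le_ncard hadj v)),
        fun j hj => honly i v hiv h3 j hj.ne'⟩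
    obtain ⟨e, f, h⟩ := exists_cycleColors_of_disjoint
      (A := fun i => nearPalette G (Set.range u) c (u i))
      (B := fun i => farPalette G (Set.range u) c (u i)) (D := fun _ _ => False)
      (z := CanLeaveZero G u) (fun _ => zero_notMem_farPalette)
      (hu.card_nearPalette_le_two hG') (fun i => hu.card_le_of_not_canLeaveZero hG')
      (hz 0 p hp hup (Sym2.mem_mk_left _ _)) (hz 2 q hq huq (Sym2.mem_mk_right _ _)) hd
    refine hu.exists_goodColoring hG' hcG h ?_ ?_ (fun _ _ => False.elim)
    · intro i hi
      obtain ⟨v, hv, hiv, -⟩ := hu.exists_of_not_canLeaveZero hG' hi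
      exact ⟨v, hv, hiv⟩
    · intro i v hi hv hiv
      refine ⟨(hi v hv hiv).1, fun y hy hvy hy0 => ?_, fun j hj hjv => hi.eq_of_adj hj hv hiv hjv⟩
      have hvy' := mem_edgesOff.2 ⟨hvy, hv, hy⟩
      by_cases hvpq : v ∈ s(p, q)
      · exact hoff (hc.matching _ (hsub _ hvy') _ hpqH v (Sym2.mem_mk_left _ _) hvpq hy0 hα ▸ hvy')
      · exact hu.color_ne_zero hG' hc hiv (fun _ h => absurd (Sym2.mem_iff.2 h) hvpq) hv hy hvy hy0
  · have hfar : ∀ i v, v ∉ Set.range u → G.Adj (u i) v → v ∈ s(p, q) →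
        c s(p, q) ∉ farPalette G (Set.range u) c (u i) := by
      intro i v hv hiv hvpq h
      obtain ⟨-, w, x, y, hw, hiw, hwx, hxy, hk⟩ := mem_farPalette.1 h
      obtain rfl := hu.eq_of_adj hG' hv hw hiv hiw
      refine hoff (hc.induced _ hpqH _ (hsub _ hxy) v x hvpq (Sym2.mem_mk_left _ _)
        (hwx.imp_right fun h => ⟨hv, (mem_edgesOff.1 hxy).2.1, Or.inl h⟩) hk.symm hα ▸ hxy)
    obtain ⟨e, f, h⟩ := exists_cycleColors_pinned
      (A := fun i => nearPalette G (Set.range u) c (u i))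
      (B := fun i => farPalette G (Set.range u) c (u i))
      (D := fun i j => i = 0 ∧ j = 2 ∨ i = 2 ∧ j = 0)
      (z := fun i => (i = 1 ∨ i = 3) ∧ CanLeaveZero G u i)
      (fun _ => zero_notMem_nearPalette) (fun _ => zero_notMem_farPalette)
      (hu.card_nearPalette_le_two hG')
      (fun h => hu.card_le_of_not_canLeaveZero hG' fun h' => h ⟨by simp, h'⟩)
      (fun h => hu.card_le_of_not_canLeaveZero hG' fun h' => h ⟨by simp, h'⟩) hα
      (hfar 0 p hp hup (Sym2.mem_mk_left _ _)) (hfar 2 q hq huq (Sym2.mem_mk_right _ _))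
      (by simp) (by simp) (by simp) (by simp) hd
    refine hu.exists_goodColoring hG' hcG h ?_ ?_ ?_
    · intro i hi
      by_cases hi' : i = 1 ∨ i = 3
      · obtain ⟨v, hv, hiv, -⟩ := hu.exists_of_not_canLeaveZero hG' fun h => hi ⟨hi', h⟩
        exact ⟨v, hv, hiv⟩
      · obtain rfl | rfl : i = 0 ∨ i = 2 := by clear * - hi'; decide +revert
        exacts [⟨p, hp, hup⟩, ⟨q, hq, huq⟩]
    · rintro i v ⟨hi', hi⟩ hv hiv
      refine ⟨(hi v hv hiv).1, fun y hy hvy => ?_, fun j hj hjv => hi.eq_of_adj hj.2 hv hiv hjv⟩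
      refine hu.color_ne_zero hG' hc hiv (fun _ h => ?_) hv hy hvy
      rcases h with rfl | rfl
      · exact ⟨0, by rintro rfl; simp at hi', hup⟩
      · exact ⟨2, by rintro rfl; simp at hi', huq⟩
    · rintro i j (⟨rfl, rfl⟩ | ⟨rfl, rfl⟩)
      · refine ⟨hu.not_chord hG' hp hup, fun v w hv hw hiv hjw => ?_⟩
        rw [hu.eq_of_adj hG' hv hp hiv hup, hu.eq_of_adj hG' hw hq hjw huq]
        exact ⟨hpq, hnpq⟩
      · refine ⟨hu.not_chord hG' hq huq, fun v w hv hw hiv hjw => ?_⟩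
        rw [hu.eq_of_adj hG' hv hq hiv huq, hu.eq_of_adj hG' hw hp hjw hup]
        exact ⟨hpq.symm, fun h => hnpq h.symm⟩

theorem not_isFourCycle_of_minCounter (hG : MinCounter V G) : ¬IsFourCycle G u := by
  intro hu
  refine hG.2.1 ?_
  by_cases hd : ∀ i v w, v ∉ Set.range u → w ∉ Set.range u → G.Adj (u i) v →
      G.Adj (u (i + 2)) w → v = w ∨ G.Adj v w
  · exact hu.exists_goodColoring_of_diagonals hG hd
  · push Not at hd
    obtain ⟨i, v, w, hv, hw, hiv, hjw, hvw, hnvw⟩ := hd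
    have hr : ∀ x, x ∉ Set.range u → x ∉ Set.range fun j => u (j + i) := by
      rintro x hx ⟨j, rfl⟩
      exact hx ⟨_, rfl⟩
    refine (hu.rotate i).exists_goodColoring_of_not_adj hG (hr v hv) (hr w hw) ?_ ?_ hvw hnvw
    · simpa using hiv
    · simpa [add_comm] using hjw
end

/-- A minimal counterexample contains no cycle of length 4. -/
theorem minCounter_no_C4 {V : Type} [Finite V] (G : SimpleGraph V)
    (hG : MinCounter V G) :
    ∀ (v : V) (w : G.Walk v v), w.IsCycle → w.length ≠ 4 := by
  intro v w hw hl
  exact not_isFourCycle_of_minCounter hG (hw.isFourCycle hl)
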